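/- arXiv:2206.14909 — 2 statements merged into one kernel-verified Lean document; each statement's English description precedes it below -/
import Mathlib

section
/- Every graph with maximum degree 3 on n vertices that has a Hamiltonian cycle admits a straight-line RAC drawing of O(n²) area. -/
open scoped Classical

noncomputable section

/-- A point of the Euclidean plane. -/
abbrev Pt : Type := ℝ × ℝ

/-- The segments with endpoints `a, b` and `c, d` are orthogonal:
their direction vectors have zero inner product. -/
def SegOrth (a b c d : Pt) : Prop :=
  (b.1 - a.1) * (d.1 - c.1) + (b.2 - a.2) * (d.2 - c.2) = 0

/-- The degree of a vertex in a simple graph. -/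
def vdeg {V : Type*} (G : SimpleGraph V) (v : V) : ℕ := (G.neighborSet v).ncard

/-- `M` is a matching in `G`: a set of edges of `G` that are pairwise non-adjacent. -/
def IsMatchingOn {V : Type*} (G : SimpleGraph V) (M : Set (Sym2 V)) : Prop :=
  M ⊆ G.edgeSet ∧ ∀ e ∈ M, ∀ f ∈ M, e ≠ f → ∀ v : V, v ∈ e → v ∉ f

/-- `G` is `k`-edge-colorable: its edge set is partitioned into `k` matchings. -/
def EdgeColorable {V : Type*} (G : SimpleGraph V) (k : ℕ) : Prop :=
  ∃ M : Fin k → Set (Sym2 V),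
    (∀ i, IsMatchingOn G (M i)) ∧
    (∀ i j, i ≠ j → Disjoint (M i) (M j)) ∧
    (⋃ i, M i) = G.edgeSet

/-- `p` is a straight-line RAC drawing of `G`: vertices are at pairwise distinct points,
each edge is the closed segment between its endpoints, no edge passes through another
vertex, edges sharing an endpoint meet only there, and any two edges with no common
endpoint that intersect do so orthogonally. -/
structure IsRACDrawing {V : Type*} (G : SimpleGraph V) (p : V → Pt) : Prop where
  inj : Function.Injective p
  vertex_off : ∀ u v w : V, G.Adj u v → w ≠ u → w ≠ v →
    p w ∉ segment ℝ (p u) (p v)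
  shared : ∀ u v w : V, G.Adj u v → G.Adj u w → v ≠ w →
    segment ℝ (p u) (p v) ∩ segment ℝ (p u) (p w) ⊆ {p u}
  rac : ∀ u v u' v' : V, G.Adj u v → G.Adj u' v' →
    u ≠ u' → u ≠ v' → v ≠ u' → v ≠ v' →
    (segment ℝ (p u) (p v) ∩ segment ℝ (p u') (p v')).Nonempty →
    SegOrth (p u) (p v) (p u') (p v')

/-- All points of `P` are integer grid points lying in an axis-aligned square
of side length `side`. -/
def InGridSquare (side : ℝ) (P : Set Pt) : Prop :=
  (∀ q ∈ P, ∃ a b : ℤ, q = ((a : ℝ), (b : ℝ))) ∧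
  ∃ x0 y0 : ℝ, ∀ q ∈ P, x0 ≤ q.1 ∧ q.1 ≤ x0 + side ∧ y0 ≤ q.2 ∧ q.2 ≤ y0 + side

/-- The list of consecutive segments (as pairs of endpoints) of a polyline given
by its list of points. -/
def polySegs (l : List Pt) : List (Pt × Pt) := l.zip l.tail

/-- The set of plane points covered by a polyline given by its list of points. -/
def polySet (l : List Pt) : Set Pt := ⋃ s ∈ polySegs l, segment ℝ s.1 s.2

/-- `p, poly` is a `k`-bend RAC drawing of `G`: each edge `e` is drawn as the polyline
through the list of points `poly e` (at most `k + 1` segments, i.e. at most `k + 2`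
points) joining the two endpoints of `e`; no edge passes through another vertex; edges
sharing an endpoint meet only at that endpoint; any two distinct edges intersect in
finitely many points; and wherever segments of two distinct edges meet (other than at
the point of a common endvertex) the two segments are orthogonal. -/
structure IsBendRACDrawing {V : Type*} (k : ℕ) (G : SimpleGraph V)
    (p : V → Pt) (poly : Sym2 V → List Pt) : Prop where
  inj : Function.Injective p
  ends : ∀ e ∈ G.edgeSet, ∃ u v : V, e = s(u, v) ∧
    (poly e).head? = some (p u) ∧ (poly e).getLast? = some (p v)
  nsegs : ∀ e ∈ G.edgeSet, 2 ≤ (poly e).length ∧ (poly e).length ≤ k + 2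
  vertex_off : ∀ e ∈ G.edgeSet, ∀ w : V, w ∉ e → p w ∉ polySet (poly e)
  shared : ∀ e ∈ G.edgeSet, ∀ e' ∈ G.edgeSet, e ≠ e' → ∀ w : V, w ∈ e → w ∈ e' →
    polySet (poly e) ∩ polySet (poly e') ⊆ {p w}
  fin_inter : ∀ e ∈ G.edgeSet, ∀ e' ∈ G.edgeSet, e ≠ e' →
    (polySet (poly e) ∩ polySet (poly e')).Finite
  rac : ∀ e ∈ G.edgeSet, ∀ e' ∈ G.edgeSet, e ≠ e' →
    ∀ s ∈ polySegs (poly e), ∀ s' ∈ polySegs (poly e'),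
    ∀ x : Pt, x ∈ segment ℝ s.1 s.2 → x ∈ segment ℝ s'.1 s'.2 →
    (∀ w : V, w ∈ e → w ∈ e' → x ≠ p w) →
    SegOrth s.1 s.2 s'.1 s'.2

/-- All vertex points and bend points of a polyline drawing. -/
def drawingPoints {V : Type*} (G : SimpleGraph V) (p : V → Pt)
    (poly : Sym2 V → List Pt) : Set Pt :=
  Set.range p ∪ {q | ∃ e ∈ G.edgeSet, q ∈ poly e}

/-- `F` is (the edge set of) a 2-factor of `G`: a spanning subgraph in which every
vertex has degree exactly 2. -/
def Is2Factor {V : Type*} (G : SimpleGraph V) (F : Set (Sym2 V)) : Prop :=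
  F ⊆ G.edgeSet ∧ ∀ v : V, {e ∈ F | v ∈ e}.ncard = 2

/-- The connected components of the (2-regular) spanning subgraph with edge set `F`
that are odd cycles, i.e. have an odd number of vertices. -/
def oddComps {V : Type*} (F : Set (Sym2 V)) :
    Set ((SimpleGraph.fromEdgeSet F).ConnectedComponent) :=
  {C | Odd C.supp.ncard}

/-- `G` has oddness `k`: the minimum over all 2-factors of the number of odd-cycle
components equals `k` (in particular a 2-factor exists). -/
def HasOddness {V : Type*} (G : SimpleGraph V) (k : ℕ) : Prop :=
  (∃ F, Is2Factor G F ∧ (oddComps F).ncard = k) ∧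
  (∀ F, Is2Factor G F → k ≤ (oddComps F).ncard)

/-- `G` has no cut-edge. -/
def Bridgeless {V : Type*} (G : SimpleGraph V) : Prop := ∀ e, ¬ G.IsBridge e


set_option linter.unusedSimpArgs false

def endsOf (E : List (ℕ × ℕ)) : List ℕ := E.flatMap fun e => [e.1, e.2]

def BOk (E : List (ℕ × ℕ)) (l : List ℕ) : Prop :=
  ∀ a w b, l = a ++ w :: b →
    (if a = [] then 0 else 1) + (if b = [] then 0 else 1) ≤ (endsOf E).count w

def AOk (E1 : List (ℕ × ℕ)) (e : ℕ × ℕ) (l : List ℕ) : Prop :=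
  ∃ a b c, (l = a ++ e.1 :: b ++ e.2 :: c ∨ l = a ++ e.2 :: b ++ e.1 :: c) ∧
    ∀ w ∈ b, 2 ≤ (endsOf E1).count w

def StOk (N : ℕ) (E : List (ℕ × ℕ)) (Ls : List (List ℕ)) : Prop :=
  Ls.flatten.Perm (List.range N) ∧ (∀ l ∈ Ls, BOk E l) ∧
    ∀ E1 e E2, E = E1 ++ e :: E2 → ∃ l ∈ Ls, AOk E1 e l

theorem BOk.reverse {E l} (h : BOk E l) : BOk E l.reverse := by
  intro a w b hl
  have : l = b.reverse ++ w :: a.reverse := by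
    have := congrArg List.reverse hl
    simpa using this
  have := h _ _ _ this
  simp only [List.reverse_eq_nil_iff] at this
  omega

theorem AOk.reverse {E e l} (h : AOk E e l) : AOk E e l.reverse := by
  obtain ⟨a, b, c, h1, h2⟩ := h
  refine ⟨c.reverse, b.reverse, a.reverse, ?_, by simpa using h2⟩
  rcases h1 with h1 | h1
  · right; simp [h1]
  · left; simp [h1]

theorem AOk.append {E e l} (h : AOk E e l) (p q : List ℕ) : AOk E e (p ++ l ++ q) := by
  obtain ⟨a, b, c, h1, h2⟩ := h
  refine ⟨p ++ a, b, c ++ q, ?_, h2⟩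
  rcases h1 with h1 | h1
  · left; simp [h1]
  · right; simp [h1]

theorem StOk.perm {N E Ls Ls'} (h : StOk N E Ls) (hp : Ls.Perm Ls') : StOk N E Ls' := by
  obtain ⟨h1, h2, h3⟩ := h
  refine ⟨hp.symm.flatten.trans h1, fun l hl => h2 l (hp.mem_iff.2 hl), fun E1 e E2 he => ?_⟩
  obtain ⟨l, hl, h⟩ := h3 E1 e E2 he
  exact ⟨l, hp.mem_iff.1 hl, h⟩

theorem StOk.rev {N E l Ls} (h : StOk N E (l :: Ls)) : StOk N E (l.reverse :: Ls) := by
  obtain ⟨h1, h2, h3⟩ := h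
  refine ⟨?_, ?_, ?_⟩
  · refine List.Perm.trans ?_ h1
    simp only [List.flatten_cons]
    exact (List.reverse_perm l).append_right _
  · intro m hm
    rcases List.mem_cons.1 hm with rfl | hm
    · exact (h2 l (by simp)).reverse
    · exact h2 m (by simp [hm])
  · intro E1 e E2 he
    obtain ⟨m, hm, h⟩ := h3 E1 e E2 he
    rcases List.mem_cons.1 hm with rfl | hm
    · exact ⟨_, List.mem_cons_self, h.reverse⟩
    · exact ⟨m, by simp [hm], h⟩

theorem BOk.end_of {E l u} (h : BOk E l) (hu : u ∈ l) (hc : (endsOf E).count u ≤ 1) :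
    (∃ a, l = a ++ [u]) ∨ ∃ b, l = u :: b := by
  obtain ⟨a, b, rfl⟩ := List.append_of_mem hu
  have := h a u b rfl
  by_cases ha : a = []
  · right; exact ⟨b, by simp [ha]⟩
  · by_cases hb : b = []
    · left; exact ⟨a, by simp [hb]⟩
    · simp [ha, hb] at this; omega

theorem endsOf_snoc (E e) : endsOf (E ++ [e]) = endsOf E ++ [e.1, e.2] := by
  simp [endsOf]

theorem BOk.mono {E l} (e) (h : BOk E l) : BOk (E ++ [e]) l := by
  intro a w b hl
  refine (h a w b hl).trans ?_
  rw [endsOf_snoc, List.count_append]; omega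

theorem snoc_split {α : Type*} {E E1 E2 : List α} {e f : α} (h : E ++ [f] = E1 ++ e :: E2) :
    (E = E1 ∧ f = e) ∨ ∃ E2', E = E1 ++ e :: E2' := by
  rcases List.eq_nil_or_concat E2 with rfl | ⟨E2', g, rfl⟩
  · left
    have := List.append_inj' h rfl
    simpa using this
  · right
    refine ⟨E2', ?_⟩
    have h' : E ++ [f] = (E1 ++ e :: E2') ++ [g] := by simpa using h
    exact (List.append_inj' h' rfl).1

theorem blocks (N : ℕ) (E : List (ℕ × ℕ)) : (∀ e ∈ E, e.1 ≠ e.2 ∧ e.1 < N ∧ e.2 < N) →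
    (∀ w, (endsOf E).count w ≤ 2) → ∃ Ls, StOk N E Ls := by
  induction E using List.reverseRecOn with
  | nil =>
    intro _ _
    refine ⟨(List.range N).map fun i => [i], ?_, ?_, ?_⟩
    · have : ∀ l : List ℕ, (l.map fun i => [i]).flatten = l := by
        intro l; induction l with
        | nil => rfl
        | cons a l ih => simp [ih]
      rw [this]
    · intro l hl a w b h
      obtain ⟨i, -, rfl⟩ := List.mem_map.1 hl
      have : a = [] ∧ b = [] := by
        cases a <;> simp_all
      simp [this]
    · intro E1 e E2 h
      simp at h
  | append_singleton E e ih =>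
    intro hE hc
    obtain ⟨Ls, hS⟩ := ih (fun f hf => hE f (by simp [hf])) (fun w => by
      have := hc w
      rw [endsOf_snoc, List.count_append] at this; omega)
    obtain ⟨u, v⟩ := e
    obtain ⟨huv, hu, hv⟩ := hE (u, v) (by simp)
    simp only at huv hu hv
    have cu : (endsOf E).count u ≤ 1 := by
      have := hc u
      rw [endsOf_snoc, List.count_append] at this
      simp at this; omega
    have cv : (endsOf E).count v ≤ 1 := by
      have := hc v
      rw [endsOf_snoc, List.count_append] at this
      simp [List.count_cons] at this; omega
    have step1 : ∃ a Ls', StOk N E ((a ++ [u]) :: Ls') := by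
      have : u ∈ Ls.flatten := hS.1.mem_iff.2 (by simpa using hu)
      obtain ⟨l, hl, hul⟩ := List.mem_flatten.1 this
      have hS' := hS.perm (List.perm_cons_erase hl)
      rcases (hS.2.1 l hl).end_of hul cu with ⟨a, rfl⟩ | ⟨b, rfl⟩
      · exact ⟨a, _, hS'⟩
      · refine ⟨b.reverse, Ls.erase (u :: b), ?_⟩
        simpa using hS'.rev
    obtain ⟨a, Ls', hS⟩ := step1
    have hvm : v ∈ ((a ++ [u]) :: Ls').flatten := hS.1.mem_iff.2 (by simpa using hv)
    have hB0 := hS.2.1 _ List.mem_cons_self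
    rw [List.flatten_cons, List.mem_append] at hvm
    rcases hvm with hva | hvL
    · -- closing edge
      have : ∃ a', a = v :: a' := by
        have hva : v ∈ a := by
          simpa [huv.symm] using hva
        obtain ⟨p, q, rfl⟩ := List.append_of_mem hva
        have := hB0 p v (q ++ [u]) (by simp)
        by_cases hp : p = []
        · exact ⟨q, by simp [hp]⟩
        · simp [hp] at this; omega
      obtain ⟨a', rfl⟩ := this
      refine ⟨_, hS.1, fun l hl => (hS.2.1 l hl).mono _, ?_⟩
      intro E1 e E2 he
      rcases snoc_split he with ⟨rfl, rfl⟩ | ⟨E2', h⟩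
      · refine ⟨_, List.mem_cons_self, [], a', [], Or.inr (by simp), ?_⟩
        intro w hw
        obtain ⟨p, q, rfl⟩ := List.append_of_mem hw
        have := hB0 (v :: p) w (q ++ [u]) (by simp)
        simpa using this
      · exact hS.2.2 _ _ _ h
    · have step2 : ∃ b Ls'', StOk N E ((v :: b) :: (a ++ [u]) :: Ls'') := by
        obtain ⟨l, hl, hul⟩ := List.mem_flatten.1 hvL
        have hB := (hS.2.1 l (by simp [hl]))
        have hS' : StOk N E (l :: (a ++ [u]) :: Ls'.erase l) :=
          hS.perm (((List.perm_cons_erase hl).cons _).trans (List.Perm.swap _ _ _))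
        rcases hB.end_of hul cv with ⟨b, rfl⟩ | ⟨b, rfl⟩
        · refine ⟨b.reverse, Ls'.erase (b ++ [v]), ?_⟩
          simpa using hS'.rev
        · exact ⟨b, _, hS'⟩
      obtain ⟨b, Ls'', hS⟩ := step2
      have hBv := hS.2.1 (v :: b) (by simp)
      refine ⟨(a ++ u :: v :: b) :: Ls'', ?_, ?_, ?_⟩
      · refine List.Perm.trans ?_ hS.1
        simp only [List.flatten_cons]
        have : (a ++ u :: v :: b) = (a ++ [u]) ++ (v :: b) := by simp
        rw [this, ← List.append_assoc (v :: b)]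
        exact List.perm_append_comm.append_right _
      · intro l hl
        rcases List.mem_cons.1 hl with rfl | hl
        · intro p w q h
          have ku : 1 ≤ List.count u [u, v] := by simp
          have kv : 1 ≤ List.count v [u, v] := by simp [List.count_cons]
          have h' : (a ++ [u]) ++ (v :: b) = p ++ (w :: q) := by simpa using h
          rcases List.append_eq_append_iff.1 h' with ⟨c, h1, h2⟩ | ⟨c, h1, h2⟩
          · cases c with
            | nil =>
              simp at h2
              obtain ⟨rfl, rfl⟩ := h2
              have := hBv [] v b rfl
              rw [endsOf_snoc, List.count_append]
              simp only [List.cons_ne_nil, List.append_eq_nil_iff, and_false, false_and, if_true, if_false, reduceCtorEq] at this ⊢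

              split_ifs at this ⊢ <;> omega
            | cons d c =>
              simp at h2
              obtain ⟨rfl, rfl⟩ := h2
              have := hBv (v :: c) w q rfl
              rw [endsOf_snoc, List.count_append]
              simp only [List.cons_ne_nil, List.append_eq_nil_iff, and_false, false_and, if_true, if_false, reduceCtorEq] at this ⊢

              split_ifs at this ⊢ <;> omega
          · rcases List.eq_nil_or_concat c with rfl | ⟨c', g, rfl⟩
            · simp at h2
              obtain ⟨rfl, rfl⟩ := h2
              have := hBv [] w q rfl
              rw [endsOf_snoc, List.count_append]
              simp only [List.cons_ne_nil, List.append_eq_nil_iff, and_false, false_and, if_true, if_false, reduceCtorEq] at this ⊢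

              split_ifs at this ⊢ <;> omega
            · cases c' with
              | nil =>
                have : a = p ∧ u = g := by simpa using List.append_inj' h1 rfl
                obtain ⟨rfl, rfl⟩ := this
                simp at h2
                obtain ⟨rfl, rfl⟩ := h2
                have := hB0 a w [] rfl
                rw [endsOf_snoc, List.count_append]
                simp only [List.cons_ne_nil, List.append_eq_nil_iff, and_false, false_and, if_true, if_false, reduceCtorEq] at this ⊢

                split_ifs at this ⊢ <;> omega
              | cons d c' =>
                simp at h2
                obtain ⟨rfl, rfl⟩ := h2
                have := hB0 p w (c' ++ [g]) (by simpa using h1)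
                rw [endsOf_snoc, List.count_append]
                simp only [List.cons_ne_nil, List.append_eq_nil_iff, and_false, false_and, if_true, if_false, reduceCtorEq] at this ⊢

                split_ifs at this ⊢ <;> omega
        · exact (hS.2.1 l (by simp [hl])).mono _
      · intro E1 e E2 he
        rcases snoc_split he with ⟨rfl, rfl⟩ | ⟨E2', h⟩
        · exact ⟨_, List.mem_cons_self, a, [], b, Or.inl (by simp), by simp⟩
        · obtain ⟨l, hl, hA⟩ := hS.2.2 _ _ _ h
          rcases List.mem_cons.1 hl with rfl | hl
          · exact ⟨_, List.mem_cons_self, by simpa using hA.append (a ++ [u]) []⟩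
          · rcases List.mem_cons.1 hl with rfl | hl
            · exact ⟨_, List.mem_cons_self, by simpa using hA.append [] (v :: b)⟩
            · exact ⟨l, by simp [hl], hA⟩

theorem idx_between {A B C : List ℕ} {u v w : ℕ} (hn : (A ++ u :: B ++ v :: C).Nodup)
    (hw : w ∈ A ++ u :: B ++ v :: C)
    (h1 : (A ++ u :: B ++ v :: C).idxOf u < (A ++ u :: B ++ v :: C).idxOf w)
    (h2 : (A ++ u :: B ++ v :: C).idxOf w < (A ++ u :: B ++ v :: C).idxOf v) : w ∈ B := by
  have hu : (A ++ u :: B ++ v :: C).idxOf u = A.length := by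
    have : u ∉ A := by
      intro h; simp [List.nodup_append] at hn; grind
    rw [List.append_assoc, List.idxOf_append_of_notMem this]; simp
  have hv : (A ++ u :: B ++ v :: C).idxOf v = (A ++ u :: B).length := by
    have : v ∉ A ++ u :: B := by
      intro h; rw [List.nodup_append] at hn; grind
    rw [List.idxOf_append_of_notMem this]; simp
  rw [hu] at h1
  rw [hv] at h2
  by_cases hA : w ∈ A
  · rw [List.append_assoc, List.idxOf_append_of_mem hA] at h1
    have := List.idxOf_lt_length_of_mem hA; omega
  by_cases hB : w ∈ A ++ u :: B
  · simp only [List.mem_append, List.mem_cons] at hB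
    rcases hB with h | rfl | h
    · exact absurd h hA
    · omega
    · exact h
  · rw [List.idxOf_append_of_notMem hB] at h2; omega

theorem columns (N : ℕ) (E : List (ℕ × ℕ)) (hE : ∀ e ∈ E, e.1 ≠ e.2 ∧ e.1 < N ∧ e.2 < N)
    (hc : ∀ w, (endsOf E).count w ≤ 2) :
    ∃ x : ℕ → ℕ, (∀ i < N, x i < N) ∧ (∀ i < N, ∀ j < N, x i = x j → i = j) ∧
      ∀ E1 e E2, E = E1 ++ e :: E2 → ∀ w < N,
        ((x e.1 < x w ∧ x w < x e.2) ∨ (x e.2 < x w ∧ x w < x e.1)) →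
          2 ≤ (endsOf E1).count w := by
  obtain ⟨Ls, h1, -, h3⟩ := blocks N E hE hc
  have hm : ∀ i < N, i ∈ Ls.flatten := fun i hi => h1.mem_iff.2 (by simpa using hi)
  have hnd : Ls.flatten.Nodup := h1.nodup_iff.2 List.nodup_range
  refine ⟨fun i => Ls.flatten.idxOf i, ?_, ?_, ?_⟩
  · intro i hi
    have := List.idxOf_lt_length_of_mem (hm i hi)
    rw [h1.length_eq] at this
    simpa using this
  · intro i hi j hj hij
    exact (List.idxOf_inj (hm i hi)).1 hij
  · intro E1 e E2 he w hw hb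
    obtain ⟨l, hl, hA⟩ := h3 E1 e E2 he
    obtain ⟨P, Q, rfl⟩ := List.append_of_mem hl
    have hA' := hA.append P.flatten Q.flatten
    have hmw := hm w hw
    have hfl : (P ++ l :: Q).flatten = P.flatten ++ l ++ Q.flatten := by simp
    simp only [hfl] at hb hmw hnd
    obtain ⟨a, b, c, h | h, hcnt⟩ := hA'
    · simp only [h] at hb hmw hnd
      apply hcnt
      rcases hb with hb | hb
      · exact idx_between hnd hmw hb.1 hb.2
      · exfalso
        have h1 : (a ++ e.1 :: b ++ e.2 :: c).idxOf e.1 ≤ a.length := by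
          rw [List.append_assoc, List.idxOf_append]; split_ifs with h
          · exact (List.idxOf_lt_length_of_mem h).le
          · simp
        have h2 : a.length < (a ++ e.1 :: b ++ e.2 :: c).idxOf e.2 := by
          have : e.2 ∉ a ++ e.1 :: b := by
            intro h; rw [List.nodup_append] at hnd; grind
          rw [List.idxOf_append_of_notMem this]; simp
        omega
    · simp only [h] at hb hmw hnd
      apply hcnt
      rcases hb with hb | hb
      · exfalso
        have h1 : (a ++ e.2 :: b ++ e.1 :: c).idxOf e.2 ≤ a.length := by
          rw [List.append_assoc, List.idxOf_append]; split_ifs with h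
          · exact (List.idxOf_lt_length_of_mem h).le
          · simp
        have h2 : a.length < (a ++ e.2 :: b ++ e.1 :: c).idxOf e.1 := by
          have : e.1 ∉ a ++ e.2 :: b := by
            intro h; rw [List.nodup_append] at hnd; grind
          rw [List.idxOf_append_of_notMem this]; simp
        omega
      · exact idx_between hnd hmw hb.1 hb.2

def rowf (s i : ℕ) : ℤ := if i ≤ s then ((i : ℤ) - s) / 2 else ((i : ℤ) - s + 1) / 2

theorem rowf_mono (s : ℕ) {i j : ℕ} (h : i ≤ j) : rowf s i ≤ rowf s j := by
  unfold rowf; split_ifs <;> omega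

theorem rowf_strict (s : ℕ) {i j : ℕ} (h : i + 2 ≤ j) : rowf s i < rowf s j := by
  unfold rowf; split_ifs <;> omega

theorem rowf_pair (s i : ℕ) (h : i ≠ s) (h1 : 1 ≤ i) :
    rowf s i = rowf s (i + 1) ∨ rowf s (i - 1) = rowf s i := by
  unfold rowf; split_ifs <;> omega

def linkP (n s i : ℕ) : Prop := 1 ≤ i ∧ i + 1 < n ∧ rowf s i ≠ rowf s (i + 1)

def linkV (n s m : ℕ) : List ℕ :=
  ((List.range m).filter fun i => decide (linkP n s i)).flatMap fun i => [i, i + 1]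

def linkE (n s : ℕ) (col : ℕ → ℕ) (m : ℕ) : List (ℕ × ℕ) :=
  ((List.range m).filter fun i => decide (linkP n s i)).map fun i => (col i, col (i + 1))

theorem endsOf_linkE (n s : ℕ) (col : ℕ → ℕ) (m : ℕ) :
    endsOf (linkE n s col m) = (linkV n s m).map col := by
  unfold endsOf linkE linkV
  generalize (List.range m).filter _ = l
  induction l with
  | nil => rfl
  | cons a l ih => simp at ih ⊢; exact ih

theorem count_linkV (n s m v : ℕ) : (linkV n s m).count v =
    (if v < m ∧ linkP n s v then 1 else 0) +
      (if 1 ≤ v ∧ v - 1 < m ∧ linkP n s (v - 1) then 1 else 0) := by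
  induction m with
  | zero => simp [linkV]
  | succ m ih =>
    have h : linkV n s (m + 1) = linkV n s m ++ (if linkP n s m then [m, m + 1] else []) := by
      unfold linkV
      rw [List.range_succ, List.filter_append, List.flatMap_append]
      by_cases hm : linkP n s m <;> simp [hm]
    rw [h, List.count_append, ih]
    by_cases hv : v = m
    · subst hv
      by_cases hm : linkP n s v
      · have : 1 ≤ v := hm.1
        have e1 : v - 1 < v := by omega
        have e2 : v - 1 < v + 1 := by omega
        simp [hm, List.count_cons, e1, e2]
        omega
      · by_cases h0 : 1 ≤ v
        · have e1 : v - 1 < v := by omega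
          have e2 : v - 1 < v + 1 := by omega
          simp [hm, e1, e2]
        · simp [hm, h0]
    · by_cases hv' : v = m + 1
      · subst hv'
        by_cases hm : linkP n s m
        · simp [hm, List.count_cons]
        · simp [hm]
      · have e0 : v < m + 1 ↔ v < m := by omega
        have e1 : (1 ≤ v ∧ v - 1 < m + 1 ∧ linkP n s (v - 1)) ↔
            (1 ≤ v ∧ v - 1 < m ∧ linkP n s (v - 1)) := by
          constructor <;> rintro ⟨a, b, c⟩ <;> exact ⟨a, by omega, c⟩
        have e2 : (if linkP n s m then [m, m + 1] else []).count v = 0 := by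
          split_ifs <;> simp [List.count_cons] <;> omega
        simp only [e0, e1, e2]
        omega

theorem countP_or_le (l : List ℕ) (p q r : ℕ → Bool) (h : ∀ v ∈ l, p v → q v ∨ r v) :
    l.countP p ≤ l.countP q + l.countP r := by
  induction l with
  | nil => simp
  | cons a l ih =>
    have := ih (fun v hv => h v (by simp [hv]))
    have h' := h a (by simp)
    simp only [List.countP_cons]
    cases hp : p a <;> cases hq : q a <;> cases hr : r a <;> simp_all <;> omega

theorem coords (n : ℕ) (hn : 3 ≤ n) (R : ℕ → ℕ → Prop) (hs : ∀ i j, R i j → R j i)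
    (hlt : ∀ i j, R i j → i < n)
    (hadj : ∀ i j, R i j → i ≠ j ∧ j ≠ i + 1 ∧ ¬ (i = 0 ∧ j = n - 1))
    (huniq : ∀ i j k, R i j → R i k → j = k) :
    ∃ x y : ℕ → ℤ, (x 0 = 4 * n ∧ y 0 = 0) ∧
      (∀ i, 1 ≤ i → i < n → 0 ≤ x i ∧ x i ≤ n) ∧
      (∀ i j, 1 ≤ i → i < n → 1 ≤ j → j < n → x i = x j → i = j ∨ R i j) ∧
      (∀ i j, 1 ≤ i → 1 ≤ j → R i j → x i = x j) ∧
      (y 1 = -4 * n ∧ y (n - 1) = 4 * n) ∧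
      (∀ i, 2 ≤ i → i + 2 ≤ n → -n ≤ y i ∧ y i ≤ n) ∧
      (∀ i j, 1 ≤ i → i ≤ j → j < n → y i ≤ y j) ∧
      (∀ i j, 1 ≤ i → i + 2 ≤ j → j < n → y i < y j) ∧
      (∀ j, R 0 j → y j = 0 ∧ ∀ i, 1 ≤ i → i < n → (i < j → y i < 0) ∧ (j < i → 0 < y i)) ∧
      (∀ i a b, 1 ≤ i → i + 1 < n → y i < y (i + 1) → 1 ≤ a → a < b → b < n → R a b →
        ((x i < x a ∧ x a < x (i + 1)) ∨ (x (i + 1) < x a ∧ x a < x i)) → b ≤ i ∨ i + 1 ≤ a) := by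
  obtain ⟨s, hs0⟩ : ∃ s, (∀ j, R 0 j → j = s) ∧ (s = 0 ∨ R 0 s) := by
    by_cases h : ∃ j, R 0 j
    · obtain ⟨j, hj⟩ := h
      exact ⟨j, fun k hk => huniq _ _ _ hk hj, Or.inr hj⟩
    · exact ⟨0, fun j hj => absurd ⟨j, hj⟩ h, Or.inl rfl⟩
  obtain ⟨hs1, hs2⟩ := hs0
  have hsn : s < n := by
    rcases hs2 with h | h
    · omega
    · exact hlt _ _ (hs _ _ h)
  have hsR : ∀ j, 1 ≤ s → 1 ≤ j → ¬ R s j := by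
    intro j h1 hj h
    rcases hs2 with h2 | h2
    · omega
    · have := huniq _ _ _ h (hs _ _ h2); omega
  obtain ⟨π, hπ⟩ : ∃ π : ℕ → ℕ, ∀ i, (1 ≤ i ∧ 1 ≤ π i ∧ R i (π i)) ∨
      (π i = i ∧ ∀ j, 1 ≤ i → 1 ≤ j → ¬ R i j) := by
    have : ∀ i, ∃ k, (1 ≤ i ∧ 1 ≤ k ∧ R i k) ∨ (k = i ∧ ∀ j, 1 ≤ i → 1 ≤ j → ¬ R i j) := by
      intro i
      by_cases h : ∃ j, 1 ≤ i ∧ 1 ≤ j ∧ R i j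
      · obtain ⟨j, hj⟩ := h; exact ⟨j, Or.inl hj⟩
      · exact ⟨i, Or.inr ⟨rfl, fun j a b c => h ⟨j, a, b, c⟩⟩⟩
    choose π h using this
    exact ⟨π, h⟩
  have hπR : ∀ i j, 1 ≤ i → 1 ≤ j → R i j → π i = j := by
    intro i j hi hj h
    rcases hπ i with ⟨_, _, h'⟩ | ⟨_, h'⟩
    · exact huniq _ _ _ h' h
    · exact absurd h (h' j hi hj)
  have hππ : ∀ i, π (π i) = i := by
    intro i
    rcases hπ i with ⟨a, b, h'⟩ | ⟨h, _⟩
    · exact hπR _ _ b a (hs _ _ h')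
    · rw [h, h]
  have hπs : ∀ i, π i ≠ i → i ≠ s ∧ 1 ≤ i ∧ 1 ≤ π i ∧ R i (π i) := by
    intro i hi
    rcases hπ i with ⟨a, b, h'⟩ | ⟨h, _⟩
    · refine ⟨?_, a, b, h'⟩
      rintro rfl
      exact hsR _ a b h'
    · exact absurd h hi
  have hπn : ∀ i, i < n → π i < n := by
    intro i hi
    by_cases h : π i = i
    · omega
    · exact hlt _ _ (hs _ _ (hπs i h).2.2.2)
  set col : ℕ → ℕ := fun i => min i (π i) with hcol
  have hcoln : ∀ i, i < n → col i < n := fun i hi => by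
    simp only [hcol]; omega
  have hcolw : ∀ v w, col v = w → v = w ∨ v = π w := by
    intro v w h
    simp only [hcol] at h
    have := hππ v
    rcases le_total v (π v) with h' | h'
    · left; omega
    · right; rw [← h, min_eq_right h', this]
  have hcolinj : ∀ v w, col v = col w → v = w ∨ v = π w := by
    intro v w h
    have h1 := hππ v
    have h2 := hππ w
    simp only [hcol] at h
    rcases le_total v (π v) with h' | h' <;> rcases le_total w (π w) with h'' | h''
    · left; omega
    · right; omega
    · right
      rw [min_eq_right h', min_eq_left h''] at h
      rw [← h, h1]
    · left
      rw [min_eq_right h', min_eq_right h''] at h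
      rw [← h1, h, h2]
  have hcnt1 : ∀ m v, v ≠ s → (linkV n s m).count v ≤ 1 := by
    intro m v hv
    rw [count_linkV]
    by_cases h1 : 1 ≤ v
    · rcases rowf_pair s v hv h1 with h | h
      · have : ¬ linkP n s v := fun h' => h'.2.2 h
        simp only [this, and_false, if_false]; split_ifs <;> omega
      · have : ¬ linkP n s (v - 1) := fun h' => h'.2.2 (by rw [h]; congr 1; omega)
        simp only [this, and_false, if_false]; split_ifs <;> omega
    · simp only [h1, false_and, if_false]; split_ifs <;> omega
  have hcnt2 : ∀ m v, (linkV n s m).count v ≤ 2 := by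
    intro m v
    rw [count_linkV]; split_ifs <;> omega
  have hcntw : ∀ m w, (endsOf (linkE n s col m)).count w ≤
      (linkV n s m).count w + if π w = w then 0 else (linkV n s m).count (π w) := by
    intro m w
    rw [endsOf_linkE, List.count_eq_countP, List.countP_map]
    split_ifs with hw
    · rw [List.count_eq_countP]
      apply List.countP_mono_left
      intro v _ hv
      have := hcolw v w (by simpa using hv)
      simp; omega
    · rw [List.count_eq_countP, List.count_eq_countP]
      apply countP_or_le
      intro v _ hv
      have := hcolw v w (by simpa using hv)
      simpa using this
  have hcE : ∀ w, (endsOf (linkE n s col n)).count w ≤ 2 := by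
    intro w
    refine (hcntw n w).trans ?_
    split_ifs with hw
    · simpa using hcnt2 n w
    · have h1 := hcnt1 n w (hπs w hw).1
      have h2 := hcnt1 n (π w) (hπs (π w) (by rw [hππ]; exact fun h => hw h.symm)).1
      omega
  have hsucc : ∀ i, i + 1 ≠ π i := by
    intro i h
    have := (hπs i (by omega)).2.2.2
    have := (hadj _ _ this).2.1
    omega
  have hEn : ∀ e ∈ linkE n s col n, e.1 ≠ e.2 ∧ e.1 < n ∧ e.2 < n := by
    intro e he
    unfold linkE at he
    obtain ⟨i, hi, rfl⟩ := List.mem_map.1 he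
    have hP : linkP n s i := by simpa using (List.mem_filter.1 hi).2
    refine ⟨?_, hcoln _ (by have := hP.2.1; omega), hcoln _ hP.2.1⟩
    intro h
    rcases hcolinj _ _ h.symm with h | h
    · omega
    · exact hsucc i h
  obtain ⟨X, hX1, hX2, hX3⟩ := columns n _ hEn hcE
  have hrow : ∀ i, i < n → -n ≤ rowf s i ∧ rowf s i ≤ n := by
    intro i hi; unfold rowf; split_ifs <;> omega
  refine ⟨fun i => if i = 0 then 4 * n else X (col i),
    fun i => if i = 0 then 0 else if i = 1 then -4 * n else if i = n - 1 then 4 * n else rowf s i,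
    ⟨by simp, by simp⟩, ?_, ?_, ?_, ⟨by simp, ?_⟩, ?_, ?_, ?_, ?_, ?_⟩
  · intro i h1 h2
    have := hX1 _ (hcoln i h2)
    dsimp only
    rw [if_neg (by omega)]; omega
  · intro i j h1 h2 h3 h4 h
    dsimp only at h
    rw [if_neg (by omega), if_neg (by omega)] at h
    have := hX2 _ (hcoln i h2) _ (hcoln j h4) (by exact_mod_cast h)
    rcases hcolinj _ _ this with h | h
    · exact Or.inl h
    · by_cases hj : π j = j
      · left; omega
      · right; rw [h]; exact hs _ _ (hπs j hj).2.2.2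
  · intro i j h1 h2 h
    dsimp only
    rw [if_neg (by omega), if_neg (by omega)]
    have e1 := hπR _ _ h1 h2 h
    have e2 := hπR _ _ h2 h1 (hs _ _ h)
    simp only [hcol]
    rw [e1, e2, min_comm]
  · dsimp only
    rw [if_neg (by omega), if_neg (by omega), if_pos rfl]
  · intro i h1 h2
    dsimp only
    rw [if_neg (by omega), if_neg (by omega), if_neg (by omega)]
    exact hrow i (by omega)
  · intro i j h1 h2 h3
    have := rowf_mono s h2
    have := hrow i (by omega)
    have := hrow j (by omega)
    dsimp only
    split_ifs <;> omega
  · intro i j h1 h2 h3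
    have := rowf_strict s h2
    have := hrow i (by omega)
    have := hrow j (by omega)
    dsimp only
    split_ifs <;> omega
  · intro j hj
    have hjs := hs1 j hj
    subst hjs
    have a1 := hadj _ _ hj
    have a2 : rowf j j = 0 := by unfold rowf; simp
    refine ⟨?_, ?_⟩
    · dsimp only
      rw [if_neg (by omega), if_neg (by omega), if_neg (by omega), a2]
    · intro i h1 h2
      have r1 : i < j → rowf j i < 0 := by unfold rowf; split_ifs <;> omega
      have r2 : j < i → 0 < rowf j i := by unfold rowf; split_ifs <;> omega
      dsimp only
      constructor <;> intro h
      · split_ifs <;> omega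
      · split_ifs <;> omega
  · intro i a b h1 h2 hy ha hab hb hR hx
    by_contra hcon
    push Not at hcon
    dsimp only at hx
    rw [if_neg (by omega), if_neg (by omega), if_neg (by omega)] at hx
    have hx' : (X (col i) < X (col a) ∧ X (col a) < X (col (i + 1))) ∨
        (X (col (i + 1)) < X (col a) ∧ X (col a) < X (col i)) := by exact_mod_cast hx
    have hpa := hπR _ _ ha (by omega) hR
    have hpb := hπR _ _ (by omega) ha (hs _ _ hR)
    have hca : col a = a := by simp only [hcol]; omega
    have hcb : col b = a := by simp only [hcol]; omega
    have hai : a ≠ i := by rintro rfl; omega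
    have hbi : b ≠ i + 1 := by
      intro h; rw [← h, hcb, hca] at hx'; omega
    have hrow : rowf s i ≠ rowf s (i + 1) := by
      intro h
      dsimp only at hy
      split_ifs at hy <;> omega
    have hP : linkP n s i := ⟨h1, h2, hrow⟩
    obtain ⟨E2, hE2⟩ : ∃ E2, linkE n s col n =
        linkE n s col i ++ (col i, col (i + 1)) :: E2 := by
      obtain ⟨k, rfl⟩ : ∃ k, n = i + 1 + k := ⟨n - (i + 1), by omega⟩
      unfold linkE
      rw [List.range_add, List.range_succ, List.filter_append, List.filter_append]
      simp only [List.map_append, List.append_assoc]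
      simp [hP]
    have h2c := hX3 _ _ _ hE2 (col a) (hcoln a (by omega)) hx'
    have := hcntw i (col a)
    rw [hca] at this h2c
    rw [if_neg (by omega)] at this
    have c1 := hcnt1 i a (hπs a (by omega)).1
    have c2 : (linkV n s i).count (π a) = 0 := by
      rw [hpa, count_linkV]
      rw [if_neg (by omega), if_neg (by omega)]
    omega

theorem seg_param {z a b : Pt} (h : z ∈ segment ℝ a b) :
    ∃ t : ℝ, 0 ≤ t ∧ t ≤ 1 ∧ z.1 = a.1 + t * (b.1 - a.1) ∧ z.2 = a.2 + t * (b.2 - a.2) := by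
  obtain ⟨s, t, hs, ht, hst, rfl⟩ := h
  refine ⟨t, ht, by linarith, ?_, ?_⟩
  · have : s = 1 - t := by linarith
    subst this; simp; ring
  · have : s = 1 - t := by linarith
    subst this; simp; ring

theorem seg_le1 {z a b : Pt} (h : z ∈ segment ℝ a b) {c : ℝ} (ha : a.1 ≤ c) (hb : b.1 ≤ c) :
    z.1 ≤ c := by
  obtain ⟨t, h0, h1, e, -⟩ := seg_param h
  nlinarith

theorem seg_ge1 {z a b : Pt} (h : z ∈ segment ℝ a b) {c : ℝ} (ha : c ≤ a.1) (hb : c ≤ b.1) :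
    c ≤ z.1 := by
  obtain ⟨t, h0, h1, e, -⟩ := seg_param h
  nlinarith

theorem seg_le2 {z a b : Pt} (h : z ∈ segment ℝ a b) {c : ℝ} (ha : a.2 ≤ c) (hb : b.2 ≤ c) :
    z.2 ≤ c := by
  obtain ⟨t, h0, h1, -, e⟩ := seg_param h
  nlinarith

theorem seg_ge2 {z a b : Pt} (h : z ∈ segment ℝ a b) {c : ℝ} (ha : c ≤ a.2) (hb : c ≤ b.2) :
    c ≤ z.2 := by
  obtain ⟨t, h0, h1, -, e⟩ := seg_param h
  nlinarith

theorem seg_eq2 {z a b : Pt} (h : z ∈ segment ℝ a b) (hab : a.2 ≠ b.2) (hz : z.2 = a.2) :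
    z = a := by
  obtain ⟨t, h0, h1, e1, e2⟩ := seg_param h
  have : t * (b.2 - a.2) = 0 := by linarith
  rcases mul_eq_zero.1 this with h | h
  · subst h; ext <;> simp_all
  · exact absurd (by linarith) hab

theorem seg_eq1 {z a b : Pt} (h : z ∈ segment ℝ a b) (hab : a.1 ≠ b.1) (hz : z.1 = a.1) :
    z = a := by
  obtain ⟨t, h0, h1, e1, e2⟩ := seg_param h
  have : t * (b.1 - a.1) = 0 := by linarith
  rcases mul_eq_zero.1 this with h | h
  · subst h; ext <;> simp_all
  · exact absurd (by linarith) hab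

theorem seg_far {z q p : Pt} {N : ℝ} (hN : 0 < N) (h : z ∈ segment ℝ q p) (q1 : q.1 = 4 * N)
    (q2 : q.2 = 0) (p0 : 0 ≤ p.1) (p1 : p.1 ≤ N) (p2 : p.2 = 4 * N) : N < z.1 ∨ N < z.2 := by
  obtain ⟨t, h0, h1, e1, e2⟩ := seg_param h
  rw [q1] at e1
  rw [q2, p2] at e2
  by_contra hc
  push Not at hc
  nlinarith

theorem seg_far' {z q p : Pt} {N : ℝ} (hN : 0 < N) (h : z ∈ segment ℝ q p) (q1 : q.1 = 4 * N)
    (q2 : q.2 = 0) (p0 : 0 ≤ p.1) (p1 : p.1 ≤ N) (p2 : p.2 = -4 * N) : N < z.1 ∨ z.2 < -N := by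
  obtain ⟨t, h0, h1, e1, e2⟩ := seg_param h
  rw [q1] at e1
  rw [q2, p2] at e2
  by_contra hc
  push Not at hc
  nlinarith

theorem seg_tip {z q p a : Pt} {N : ℝ} (hN : 0 < N) (h : z ∈ segment ℝ q p) (q1 : q.1 = 4 * N)
    (q2 : q.2 = 0) (p0 : 0 ≤ p.1) (p1 : p.1 ≤ N) (p2 : p.2 = 4 * N)
    (h' : z ∈ segment ℝ a p) (a1 : a.1 ≤ N) (a2 : a.2 ≤ N) : z = p := by
  rw [segment_symm] at h h'
  obtain ⟨t, h0, h1, e1, e2⟩ := seg_param h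
  obtain ⟨u, g0, g1, f1, f2⟩ := seg_param h'
  rw [q2, p2] at e2
  rw [p2] at f2
  rw [q1] at e1
  have k1 : 3 * u * N ≤ 4 * t * N := by nlinarith
  have k2 : 3 * t * N ≤ u * N := by nlinarith
  have k1' : 3 * u ≤ 4 * t := by nlinarith
  have k2' : 3 * t ≤ u := by nlinarith
  have : t = 0 := by linarith
  subst this
  ext
  · rw [e1]; ring
  · rw [e2, p2]; ring

theorem seg_tip' {z q p a : Pt} {N : ℝ} (hN : 0 < N) (h : z ∈ segment ℝ q p) (q1 : q.1 = 4 * N)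
    (q2 : q.2 = 0) (p0 : 0 ≤ p.1) (p1 : p.1 ≤ N) (p2 : p.2 = -4 * N)
    (h' : z ∈ segment ℝ a p) (a1 : a.1 ≤ N) (a2 : -N ≤ a.2) : z = p := by
  rw [segment_symm] at h h'
  obtain ⟨t, h0, h1, e1, e2⟩ := seg_param h
  obtain ⟨u, g0, g1, f1, f2⟩ := seg_param h'
  rw [q2, p2] at e2
  rw [p2] at f2
  rw [q1] at e1
  have k1 : 3 * u * N ≤ 4 * t * N := by nlinarith
  have k2 : 3 * t * N ≤ u * N := by nlinarith
  have k1' : 3 * u ≤ 4 * t := by nlinarith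
  have k2' : 3 * t ≤ u := by nlinarith
  have : t = 0 := by linarith
  subst this
  ext
  · rw [e1]; ring
  · rw [e2, p2]; ring

/-- The coordinates produced for the cyclically indexed vertices. -/
structure GoodPts (n : ℕ) (R : ℕ → ℕ → Prop) (p : ℕ → Pt) : Prop where
  hn : 3 ≤ n
  symm : ∀ i j, R i j → R j i
  lt : ∀ i j, R i j → i < n
  nadj : ∀ i j, R i j → i ≠ j ∧ j ≠ i + 1 ∧ ¬ (i = 0 ∧ j = n - 1)
  uniq : ∀ i j k, R i j → R i k → j = k
  q1 : (p 0).1 = 4 * n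
  q2 : (p 0).2 = 0
  xb : ∀ i, 1 ≤ i → i < n → 0 ≤ (p i).1 ∧ (p i).1 ≤ n
  xinj : ∀ i j, 1 ≤ i → i < n → 1 ≤ j → j < n → (p i).1 = (p j).1 → i = j ∨ R i j
  xch : ∀ i j, 1 ≤ i → 1 ≤ j → R i j → (p i).1 = (p j).1
  y1 : (p 1).2 = -4 * n
  yn : (p (n - 1)).2 = 4 * n
  yb : ∀ i, 2 ≤ i → i + 2 ≤ n → -(n : ℝ) ≤ (p i).2 ∧ (p i).2 ≤ n
  mono : ∀ i j, 1 ≤ i → i ≤ j → j < n → (p i).2 ≤ (p j).2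
  strict : ∀ i j, 1 ≤ i → i + 2 ≤ j → j < n → (p i).2 < (p j).2
  y0 : ∀ j, R 0 j → (p j).2 = 0 ∧
    ∀ i, 1 ≤ i → i < n → (i < j → (p i).2 < 0) ∧ (j < i → 0 < (p i).2)
  star : ∀ i a b, 1 ≤ i → i + 1 < n → (p i).2 < (p (i + 1)).2 → 1 ≤ a → a < b → b < n → R a b →
    (((p i).1 < (p a).1 ∧ (p a).1 < (p (i + 1)).1) ∨
      ((p (i + 1)).1 < (p a).1 ∧ (p a).1 < (p i).1)) → b ≤ i ∨ i + 1 ≤ a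

def Concl (p : ℕ → Pt) (i j k l : ℕ) (z : Pt) : Prop :=
  (∃ m, (m = i ∨ m = j) ∧ (m = k ∨ m = l) ∧ z = p m) ∨
    ((i ≠ k ∧ i ≠ l ∧ j ≠ k ∧ j ≠ l) ∧ SegOrth (p i) (p j) (p k) (p l))

theorem Concl.symm {p i j k l z} (h : Concl p i j k l z) : Concl p k l i j z := by
  rcases h with ⟨m, a, b, c⟩ | ⟨⟨a, b, c, d⟩, e⟩
  · exact Or.inl ⟨m, b, a, c⟩
  · refine Or.inr ⟨⟨a.symm, c.symm, b.symm, d.symm⟩, ?_⟩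
    unfold SegOrth at *; linarith

namespace GoodPts
variable {n : ℕ} {R : ℕ → ℕ → Prop} {p : ℕ → Pt}

theorem npos (h : GoodPts n R p) : (0 : ℝ) < n := by
  have := h.hn
  exact_mod_cast (by omega : 0 < n)

theorem inj (h : GoodPts n R p) {i j : ℕ} (hi : i < n) (hj : j < n) (e : p i = p j) : i = j := by
  have hN := h.npos
  by_cases i0 : i = 0
  · by_cases j0 : j = 0
    · omega
    · have := h.xb j (by omega) hj
      have q := h.q1
      rw [← e, i0, q] at this
      linarith
  · by_cases j0 : j = 0
    · have := h.xb i (by omega) hi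
      have q := h.q1
      rw [e, j0, q] at this
      linarith
    · rcases h.xinj i j (by omega) hi (by omega) hj (by rw [e]) with h1 | h1
      · exact h1
      · exfalso
        have a1 := h.nadj _ _ h1
        have a2 := h.nadj _ _ (h.symm _ _ h1)
        rcases lt_or_gt_of_ne a1.1 with h2 | h2
        · have := h.strict i j (by omega) (by omega) hj
          rw [e] at this; exact lt_irrefl _ this
        · have := h.strict j i (by omega) (by omega) hi
          rw [e] at this; exact lt_irrefl _ this

theorem y_up (h : GoodPts n R p) {i : ℕ} (hi : 1 ≤ i) (hi' : i + 1 < n) : (p i).2 ≤ n := by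
  have := h.npos
  by_cases h1 : i = 1
  · rw [h1, h.y1]; linarith
  · exact (h.yb i (by omega) (by omega)).2

theorem y_dn (h : GoodPts n R p) {i : ℕ} (hi : 2 ≤ i) (hi' : i < n) : -(n : ℝ) ≤ (p i).2 := by
  have := h.npos
  by_cases h1 : i = n - 1
  · rw [h1, h.yn]; linarith
  · exact (h.yb i (by omega) (by omega)).1

theorem x_ne (h : GoodPts n R p) {i : ℕ} (hi : 1 ≤ i) (hi' : i + 1 < n) :
    (p i).1 ≠ (p (i + 1)).1 := by
  intro e
  rcases h.xinj i (i + 1) hi (by omega) (by omega) hi' e with h1 | h1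
  · omega
  · exact (h.nadj _ _ h1).2.1 rfl

/-- Two path edges. -/
theorem cross11 (h : GoodPts n R p) {i k : ℕ} (hi : 1 ≤ i) (hik : i < k) (hk : k + 1 < n) {z : Pt}
    (h1 : z ∈ segment ℝ (p i) (p (i + 1))) (h2 : z ∈ segment ℝ (p k) (p (k + 1))) :
    Concl p i (i + 1) k (k + 1) z := by
  have m1 := h.mono i (i + 1) hi (by omega) (by omega)
  have m2 := h.mono (i + 1) k (by omega) (by omega) (by omega)
  have m3 := h.mono k (k + 1) (by omega) (by omega) (by omega)
  have z1 := seg_le2 h1 m1 le_rfl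
  have z2 := seg_ge2 h2 le_rfl m3
  have e1 : z.2 = (p (i + 1)).2 := by linarith
  have e2 : z.2 = (p k).2 := by linarith
  left
  by_cases hk1 : k = i + 1
  · subst hk1
    refine ⟨i + 1, Or.inr rfl, Or.inl rfl, ?_⟩
    have s := h.strict i (i + 2) hi (by omega) hk
    by_cases hy : (p (i + 1)).2 = (p i).2
    · exact seg_eq2 h2 (by intro h'; rw [← hy, h'] at s; exact lt_irrefl _ s) e2
    · rw [segment_symm] at h1
      exact seg_eq2 h1 hy e1
  · exfalso
    have s1 := h.strict i k hi (by omega) (by omega)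
    have s2 := h.strict (i + 1) (k + 1) (by omega) (by omega) (by omega)
    rw [segment_symm] at h1
    have a1 := seg_eq2 h1 (by intro h'; linarith) e1
    have a2 := seg_eq2 h2 (by intro h'; linarith) e2
    have := h.inj (by omega) (by omega) (a1.symm.trans a2)
    omega

theorem chord_x (h : GoodPts n R p) {a b : ℕ} (ha : 1 ≤ a) (hab : a < b) (hR : R a b) {z : Pt}
    (hz : z ∈ segment ℝ (p a) (p b)) : z.1 = (p a).1 := by
  have := h.xch a b ha (by omega) hR
  exact le_antisymm (seg_le1 hz le_rfl this.ge) (seg_ge1 hz le_rfl this.le)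

/-- A path edge and a chord. -/
theorem cross12 (h : GoodPts n R p) {i a b : ℕ} (hi : 1 ≤ i) (hin : i + 1 < n) (ha : 1 ≤ a)
    (hab : a < b) (hR : R a b) {z : Pt}
    (h1 : z ∈ segment ℝ (p i) (p (i + 1))) (h2 : z ∈ segment ℝ (p a) (p b)) :
    Concl p i (i + 1) a b z := by
  have hb : b < n := h.lt _ _ (h.symm _ _ hR)
  have xz := h.chord_x ha hab hR h2
  have xab := h.xch a b ha (by omega) hR
  have xne := h.x_ne hi hin
  have m1 := h.mono i (i + 1) hi (by omega) (by omega)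
  have key : ∀ m, 1 ≤ m → m < n → (p a).1 = (p m).1 → m = a ∨ m = b := by
    intro m hm hmn e
    rcases h.xinj a m ha (by omega) hm hmn e with h' | h'
    · exact Or.inl h'.symm
    · exact Or.inr (h.uniq _ _ _ h' hR)
  by_cases c1 : (p a).1 = (p i).1
  · left
    exact ⟨i, Or.inl rfl, key i hi (by omega) c1, seg_eq1 h1 xne (xz.trans c1)⟩
  by_cases c2 : (p a).1 = (p (i + 1)).1
  · left
    rw [segment_symm] at h1
    exact ⟨i + 1, Or.inr rfl, key _ (by omega) (by omega) c2, seg_eq1 h1 xne.symm (xz.trans c2)⟩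
  have nia : i ≠ a := by rintro rfl; exact c1 rfl
  have nib : i ≠ b := by rintro rfl; exact c1 xab
  have nja : i + 1 ≠ a := by rintro rfl; exact c2 rfl
  have njb : i + 1 ≠ b := by rintro rfl; exact c2 xab
  by_cases hy : (p i).2 = (p (i + 1)).2
  · right
    refine ⟨⟨nia, nib, nja, njb⟩, ?_⟩
    unfold SegOrth
    rw [← hy, xab]; ring
  exfalso
  have hlt : (p i).2 < (p (i + 1)).2 := lt_of_le_of_ne m1 hy
  have btw : ((p i).1 < (p a).1 ∧ (p a).1 < (p (i + 1)).1) ∨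
      ((p (i + 1)).1 < (p a).1 ∧ (p a).1 < (p i).1) := by
    rcases lt_or_gt_of_ne c1 with c1' | c1' <;> rcases lt_or_gt_of_ne c2 with c2' | c2'
    · exfalso
      have := seg_ge1 h1 (c := min (p i).1 (p (i + 1)).1) (min_le_left _ _) (min_le_right _ _)
      rw [xz] at this
      exact absurd (lt_min c1' c2') (not_lt.2 this)
    · exact Or.inr ⟨c2', c1'⟩
    · exact Or.inl ⟨c1', c2'⟩
    · exfalso
      have := seg_le1 h1 (c := max (p i).1 (p (i + 1)).1) (le_max_left _ _) (le_max_right _ _)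
      rw [xz] at this
      exact absurd (max_lt c1' c2') (not_lt.2 this)
  rcases h.star i a b hi hin hlt ha hab hb hR btw with hs | hs
  · have := seg_le2 h2 (h.mono a i ha (by omega) (by omega)) (h.mono b i (by omega) hs (by omega))
    have g := seg_ge2 h1 le_rfl m1
    have := seg_eq2 h1 hy (le_antisymm this g)
    rw [this] at xz
    exact c1 xz.symm
  · have := seg_ge2 h2 (h.mono (i + 1) a (by omega) hs (by omega))
      (h.mono (i + 1) b (by omega) (by omega) hb)
    have g := seg_le2 h1 m1 le_rfl
    rw [segment_symm] at h1
    have := seg_eq2 h1 (Ne.symm hy) (le_antisymm g this)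
    rw [this] at xz
    exact c2 xz.symm

/-- Two different chords. -/
theorem cross22 (h : GoodPts n R p) {a b c d : ℕ} (ha : 1 ≤ a) (hab : a < b) (hR : R a b)
    (hc : 1 ≤ c) (hcd : c < d) (hR' : R c d) (hne : ¬ (a = c ∧ b = d)) {z : Pt}
    (h1 : z ∈ segment ℝ (p a) (p b)) (h2 : z ∈ segment ℝ (p c) (p d)) : False := by
  have e1 := h.chord_x ha hab hR h1
  have e2 := h.chord_x hc hcd hR' h2
  rcases h.xinj a c ha (h.lt _ _ hR) hc (h.lt _ _ hR') (e1.symm.trans e2) with h' | h'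
  · subst h'
    exact hne ⟨rfl, h.uniq _ _ _ hR hR'⟩
  · have := h.uniq _ _ _ hR h'
    have := h.uniq _ _ _ hR' (h.symm _ _ h')
    omega

/-- The edge from `0` to `n - 1` and an edge not at `0`. -/
theorem cross4 (h : GoodPts n R p) {k l : ℕ} (hk : 1 ≤ k) (hkl : k < l) (hl : l < n) {z : Pt}
    (h1 : z ∈ segment ℝ (p 0) (p (n - 1))) (h2 : z ∈ segment ℝ (p k) (p l)) :
    Concl p 0 (n - 1) k l z := by
  have hn := h.hn
  have xb := h.xb (n - 1) (by omega) (by omega)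
  have xk := h.xb k hk (by omega)
  have xl := h.xb l (by omega) (by omega)
  have yk := h.y_up hk (by omega)
  by_cases hl' : l = n - 1
  · subst hl'
    exact Or.inl ⟨n - 1, Or.inr rfl, Or.inr rfl,
      seg_tip h.npos h1 h.q1 h.q2 xb.1 xb.2 h.yn h2 xk.2 yk⟩
  · exfalso
    have yl := h.y_up (i := l) (by omega) (by omega)
    rcases seg_far h.npos h1 h.q1 h.q2 xb.1 xb.2 h.yn with hf | hf
    · exact absurd (seg_le1 h2 xk.2 xl.2) (not_le.2 hf)
    · exact absurd (seg_le2 h2 yk yl) (not_le.2 hf)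

/-- The edge from `0` to `1` and an edge not at `0`. -/
theorem cross3 (h : GoodPts n R p) {k l : ℕ} (hk : 1 ≤ k) (hkl : k < l) (hl : l < n) {z : Pt}
    (h1 : z ∈ segment ℝ (p 0) (p 1)) (h2 : z ∈ segment ℝ (p k) (p l)) :
    Concl p 0 1 k l z := by
  have hn := h.hn
  have xb := h.xb 1 (by omega) (by omega)
  have xk := h.xb k hk (by omega)
  have xl := h.xb l (by omega) (by omega)
  have yl := h.y_dn (i := l) (by omega) (by omega)
  by_cases hk' : k = 1
  · subst hk'
    rw [segment_symm] at h2
    exact Or.inl ⟨1, Or.inr rfl, Or.inl rfl,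
      seg_tip' h.npos h1 h.q1 h.q2 xb.1 xb.2 h.y1 h2 xl.2 yl⟩
  · exfalso
    have yk := h.y_dn (i := k) (by omega) (by omega)
    rcases seg_far' h.npos h1 h.q1 h.q2 xb.1 xb.2 h.y1 with hf | hf
    · exact absurd (seg_le1 h2 xk.2 xl.2) (not_le.2 hf)
    · exact absurd (seg_ge2 h2 yk yl) (not_le.2 hf)

theorem hor_y (h : GoodPts n R p) {s : ℕ} (hs : R 0 s) {z : Pt}
    (h1 : z ∈ segment ℝ (p 0) (p s)) : z.2 = 0 := by
  have e1 := h.q2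
  have e2 := (h.y0 s hs).1
  exact le_antisymm (seg_le2 h1 e1.le e2.le) (seg_ge2 h1 e1.ge e2.ge)

theorem s_rng (h : GoodPts n R p) {s : ℕ} (hs : R 0 s) : 2 ≤ s ∧ s + 2 ≤ n := by
  have a := h.nadj _ _ hs
  have b := h.lt _ _ (h.symm _ _ hs)
  omega

/-- The horizontal edge at `0` and a path edge. -/
theorem cross51 (h : GoodPts n R p) {s i : ℕ} (hs : R 0 s) (hi : 1 ≤ i) (hin : i + 1 < n) {z : Pt}
    (h1 : z ∈ segment ℝ (p 0) (p s)) (h2 : z ∈ segment ℝ (p i) (p (i + 1))) :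
    Concl p 0 s i (i + 1) z := by
  have hz := h.hor_y hs h1
  have ⟨ys, hy⟩ := h.y0 s hs
  have r := h.s_rng hs
  have yi := hy i hi (by omega)
  have yj := hy (i + 1) (by omega) hin
  left
  by_cases e1 : i = s
  · subst e1
    refine ⟨i, Or.inr rfl, Or.inl rfl, seg_eq2 h2 ?_ (hz.trans ys.symm)⟩
    have := yj.2 (by omega)
    rw [ys]; exact this.ne
  by_cases e2 : i + 1 = s
  · subst e2
    rw [segment_symm] at h2
    refine ⟨i + 1, Or.inr rfl, Or.inr rfl, seg_eq2 h2 ?_ (hz.trans ys.symm)⟩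
    have := yi.1 (by omega)
    rw [ys]; exact this.ne'
  exfalso
  have m1 := h.mono i (i + 1) hi (by omega) (by omega)
  by_cases c : i < s
  · have := yj.1 (by omega)
    have := seg_le2 h2 m1 le_rfl
    linarith
  · have := yi.2 (by omega)
    have := seg_ge2 h2 le_rfl m1
    linarith

/-- The horizontal edge at `0` and a chord. -/
theorem cross52 (h : GoodPts n R p) {s a b : ℕ} (hs : R 0 s) (ha : 1 ≤ a) (hab : a < b)
    (hR : R a b) (z : Pt) : Concl p 0 s a b z := by
  right
  have h0 := h.symm _ _ hs
  refine ⟨⟨by omega, by omega, ?_, ?_⟩, ?_⟩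
  · rintro rfl
    have := h.uniq _ _ _ h0 hR
    omega
  · rintro rfl
    have := h.uniq _ _ _ h0 (h.symm _ _ hR)
    omega
  · unfold SegOrth
    rw [h.q2, (h.y0 s hs).1, h.xch a b ha (by omega) hR]; ring

def Ed (n : ℕ) (R : ℕ → ℕ → Prop) (i j : ℕ) : Prop :=
  (1 ≤ i ∧ j = i + 1 ∧ j < n) ∨ (1 ≤ i ∧ i < j ∧ R i j) ∨ (i = 0 ∧ j = 1) ∨
    (i = 0 ∧ j = n - 1) ∨ (i = 0 ∧ R 0 j)

/-- Two edges at `0`. -/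
theorem cross00 (h : GoodPts n R p) {j l : ℕ} (h1 : Ed n R 0 j) (h2 : Ed n R 0 l) (hne : j ≠ l)
    {z : Pt} (z1 : z ∈ segment ℝ (p 0) (p j)) (z2 : z ∈ segment ℝ (p 0) (p l)) : z = p 0 := by
  have hN := h.npos
  have cls : ∀ j, Ed n R 0 j → (j = 1 ∧ (p j).2 < 0) ∨ (j = n - 1 ∧ 0 < (p j).2) ∨
      (R 0 j ∧ (p j).2 = 0) := by
    intro j hj
    rcases hj with hj | hj | hj | hj | hj
    · omega
    · omega
    · left; refine ⟨hj.2, ?_⟩; rw [hj.2, h.y1]; linarith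
    · right; left; refine ⟨hj.2, ?_⟩; rw [hj.2, h.yn]; linarith
    · right; right; exact ⟨hj.2, (h.y0 j hj.2).1⟩
  have main : ∀ j l, (p j).2 < 0 → 0 ≤ (p l).2 → z ∈ segment ℝ (p 0) (p j) →
      z ∈ segment ℝ (p 0) (p l) → z = p 0 := by
    intro j l hj hl z1 z2
    have a1 := seg_le2 z1 h.q2.le hj.le
    have a2 := seg_ge2 z2 h.q2.ge hl
    exact seg_eq2 z1 (by rw [h.q2]; exact hj.ne') (by rw [h.q2]; linarith)
  have main' : ∀ j l, 0 < (p j).2 → (p l).2 ≤ 0 → z ∈ segment ℝ (p 0) (p j) →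
      z ∈ segment ℝ (p 0) (p l) → z = p 0 := by
    intro j l hj hl z1 z2
    have a1 := seg_ge2 z1 h.q2.ge hj.le
    have a2 := seg_le2 z2 h.q2.le hl
    exact seg_eq2 z1 (by rw [h.q2]; exact hj.ne) (by rw [h.q2]; linarith)
  rcases cls j h1 with ⟨a, a'⟩ | ⟨a, a'⟩ | ⟨a, a'⟩ <;>
    rcases cls l h2 with ⟨b, b'⟩ | ⟨b, b'⟩ | ⟨b, b'⟩
  · omega
  · exact main j l a' b'.le z1 z2
  · exact main j l a' b'.ge z1 z2
  · exact main' j l a' b'.le z1 z2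
  · omega
  · exact main' j l a' b'.le z1 z2
  · exact main l j b' a'.ge z2 z1
  · exact main' l j b' a'.le z2 z1
  · exact absurd (h.uniq _ _ _ a b) hne

theorem ed_lt (h : GoodPts n R p) {i j : ℕ} (e : Ed n R i j) : i < j ∧ j < n := by
  have := h.hn
  rcases e with e | e | e | e | e
  · omega
  · exact ⟨e.2.1, h.lt _ _ (h.symm _ _ e.2.2)⟩
  · omega
  · omega
  · have := h.s_rng e.2; omega

theorem cross0 (h : GoodPts n R p) {j k l : ℕ} (e : Ed n R 0 j) (e' : Ed n R k l) (hk : 1 ≤ k)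
    {z : Pt} (h1 : z ∈ segment ℝ (p 0) (p j)) (h2 : z ∈ segment ℝ (p k) (p l)) :
    Concl p 0 j k l z := by
  have lt := h.ed_lt e'
  rcases e with e | e | ⟨-, rfl⟩ | ⟨-, rfl⟩ | ⟨-, e⟩
  · omega
  · omega
  · exact h.cross3 hk lt.1 lt.2 h1 h2
  · exact h.cross4 hk lt.1 lt.2 h1 h2
  · rcases e' with ⟨_, rfl, _⟩ | ⟨_, a, b⟩ | e' | e' | e'
    · exact h.cross51 e hk lt.2 h1 h2
    · exact h.cross52 e hk a b z
    all_goals omega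

theorem cross (h : GoodPts n R p) {i j k l : ℕ} (e : Ed n R i j) (e' : Ed n R k l)
    (hne : ¬ (i = k ∧ j = l))
    {z : Pt} (h1 : z ∈ segment ℝ (p i) (p j)) (h2 : z ∈ segment ℝ (p k) (p l)) :
    Concl p i j k l z := by
  by_cases hi : i = 0
  · subst hi
    by_cases hk : k = 0
    · subst hk
      exact Or.inl ⟨0, Or.inl rfl, Or.inl rfl, h.cross00 e e' (by omega) h1 h2⟩
    · exact h.cross0 e e' (by omega) h1 h2
  · by_cases hk : k = 0
    · subst hk
      exact (h.cross0 e' e (by omega) h2 h1).symm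
    · rcases e with ⟨a1, rfl, a2⟩ | ⟨a1, a2, a3⟩ | e | e | e
      · rcases e' with ⟨b1, rfl, b2⟩ | ⟨b1, b2, b3⟩ | e | e | e
        · rcases lt_trichotomy i k with c | c | c
          · exact h.cross11 a1 c b2 h1 h2
          · omega
          · exact (h.cross11 b1 c a2 h2 h1).symm
        · exact h.cross12 a1 a2 b1 b2 b3 h1 h2
        all_goals omega
      · rcases e' with ⟨b1, rfl, b2⟩ | ⟨b1, b2, b3⟩ | e | e | e
        · exact (h.cross12 b1 b2 a1 a2 a3 h2 h1).symm
        · exact (h.cross22 a1 a2 a3 b1 b2 b3 hne h1 h2).elim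
        all_goals omega
      all_goals omega

theorem off (h : GoodPts n R p) {i j w : ℕ} (e : Ed n R i j) (hw : w < n) (wi : w ≠ i)
    (wj : w ≠ j) : p w ∉ segment ℝ (p i) (p j) := by
  intro hz
  have hn := h.hn
  have hN := h.npos
  have lt := h.ed_lt e
  by_cases w0 : w = 0
  · subst w0
    have a1 := h.xb i (by omega) (by omega)
    have a2 := h.xb j (by omega) (by omega)
    have := seg_le1 hz a1.2 a2.2
    rw [h.q1] at this
    linarith
  have xw := h.xb w (by omega) hw
  rcases e with ⟨a1, rfl, a2⟩ | ⟨a1, a2, a3⟩ | ⟨rfl, rfl⟩ | ⟨rfl, rfl⟩ | ⟨rfl, e⟩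
  · have m := h.mono i (i + 1) a1 (by omega) a2
    have g := seg_ge2 hz le_rfl m
    have l := seg_le2 hz m le_rfl
    rcases lt_or_gt_of_ne wi with c | c
    · have s := h.strict w (i + 1) (by omega) (by omega) a2
      have m' := h.mono w i (by omega) (by omega) (by omega)
      have := seg_eq2 hz (by intro h'; linarith) (by linarith)
      exact wi (h.inj hw (by omega) this)
    · have s := h.strict i w (by omega) (by omega) hw
      have m' := h.mono (i + 1) w (by omega) (by omega) (by omega)
      rw [segment_symm] at hz
      have := seg_eq2 hz (by intro h'; linarith) (by linarith)
      exact wj (h.inj hw (by omega) this)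
  · have e1 := h.chord_x a1 a2 a3 hz
    rcases h.xinj w i (by omega) hw a1 (by omega) e1 with h' | h'
    · exact wi h'
    · exact wj (h.uniq _ _ _ (h.symm _ _ h') a3)
  · have xb := h.xb 1 (by omega) (by omega)
    rcases seg_far' hN hz h.q1 h.q2 xb.1 xb.2 h.y1 with hf | hf
    · linarith [xw.2]
    · have := h.y_dn (i := w) (by omega) hw
      linarith
  · have xb := h.xb (n - 1) (by omega) (by omega)
    rcases seg_far hN hz h.q1 h.q2 xb.1 xb.2 h.yn with hf | hf
    · linarith [xw.2]
    · have := h.y_up (i := w) (by omega) (by omega)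
      linarith
  · have := h.hor_y e hz
    have q := (h.y0 j e).2 w (by omega) hw
    rcases lt_or_gt_of_ne wj with c | c
    · linarith [q.1 c]
    · linarith [q.2 c]

end GoodPts

theorem segOrth_iff (a b c d : Pt) : (SegOrth a b c d ↔ SegOrth b a c d) ∧
    (SegOrth a b c d ↔ SegOrth a b d c) := by
  unfold SegOrth
  refine ⟨⟨fun h => ?_, fun h => ?_⟩, ⟨fun h => ?_, fun h => ?_⟩⟩ <;> linarith

theorem concl_swapL {p : ℕ → Pt} {i j k l : ℕ} {z : Pt} (h : Concl p j i k l z) :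
    Concl p i j k l z := by
  rcases h with ⟨m, h1, h2, h3⟩ | ⟨⟨h1, h2, h3, h4⟩, h5⟩
  · exact Or.inl ⟨m, h1.symm, h2, h3⟩
  · exact Or.inr ⟨⟨h3, h4, h1, h2⟩, (segOrth_iff _ _ _ _).1.1 h5⟩

theorem concl_swapR {p : ℕ → Pt} {i j k l : ℕ} {z : Pt} (h : Concl p i j l k z) :
    Concl p i j k l z := by
  rcases h with ⟨m, h1, h2, h3⟩ | ⟨⟨h1, h2, h3, h4⟩, h5⟩
  · exact Or.inl ⟨m, h1, h2.symm, h3⟩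
  · exact Or.inr ⟨⟨h2, h1, h4, h3⟩, (segOrth_iff _ _ _ _).2.1 h5⟩

theorem drawing_of_cycle {V : Type} [Fintype V] (G : SimpleGraph V)
    (hd : ∀ v : V, vdeg G v ≤ 3) (n : ℕ) (hn : 3 ≤ n) (g : ℕ → V)
    (ginj : ∀ i j, i < n → j < n → g i = g j → i = j)
    (gsurj : ∀ v, ∃ i, i < n ∧ g i = v)
    (gadj : ∀ i, i + 1 < n → G.Adj (g i) (g (i + 1)))
    (glast : G.Adj (g (n - 1)) (g 0)) :
    ∃ p : V → Pt, IsRACDrawing G p ∧ InGridSquare (8 * (n : ℝ)) (Set.range p) := by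
  obtain ⟨R, hR⟩ : ∃ R : ℕ → ℕ → Prop, ∀ i j, R i j ↔ (i < n ∧ j < n ∧ G.Adj (g i) (g j) ∧
      j ≠ i + 1 ∧ i ≠ j + 1 ∧ ¬ (i = 0 ∧ j = n - 1) ∧ ¬ (i = n - 1 ∧ j = 0)) :=
    ⟨fun i j => _, fun i j => Iff.rfl⟩
  have hs : ∀ i j, R i j → R j i := by
    intro i j h
    rw [hR] at h ⊢
    obtain ⟨h1, h2, h3, h4, h5, h6, h7⟩ := h
    exact ⟨h2, h1, h3.symm, h5, h4, fun h => h7 ⟨h.2, h.1⟩, fun h => h6 ⟨h.2, h.1⟩⟩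
  have hlt : ∀ i j, R i j → i < n := fun i j h => ((hR _ _).1 h).1
  have hne : ∀ i j, R i j → i ≠ j := by
    intro i j h e
    subst e
    exact ((hR _ _).1 h).2.2.1.ne rfl
  have hadj : ∀ i j, R i j → i ≠ j ∧ j ≠ i + 1 ∧ ¬ (i = 0 ∧ j = n - 1) := by
    intro i j h
    exact ⟨hne _ _ h, ((hR _ _).1 h).2.2.2.1, ((hR _ _).1 h).2.2.2.2.2.1⟩
  have huniq : ∀ i j k, R i j → R i k → j = k := by
    intro i j k hj hk
    by_contra hjk
    have nj := hne _ _ hj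
    have nk := hne _ _ hk
    rw [hR] at hj hk
    obtain ⟨h1, h2, h3, h4, h5, h6, h7⟩ := hj
    obtain ⟨k1, k2, k3, k4, k5, k6, k7⟩ := hk
    obtain ⟨a, ha, aadj, ha'⟩ : ∃ a, a < n ∧ G.Adj (g i) (g a) ∧
        ((i + 1 < n ∧ a = i + 1) ∨ (i = n - 1 ∧ a = 0)) := by
      by_cases hi : i + 1 < n
      · exact ⟨i + 1, hi, gadj i hi, Or.inl ⟨hi, rfl⟩⟩
      · have : i = n - 1 := by omega
        exact ⟨0, by omega, by rw [this]; exact glast, Or.inr ⟨this, rfl⟩⟩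
    obtain ⟨b, hb, badj, hb'⟩ : ∃ b, b < n ∧ G.Adj (g i) (g b) ∧
        ((1 ≤ i ∧ b + 1 = i) ∨ (i = 0 ∧ b = n - 1)) := by
      by_cases hi : 1 ≤ i
      · refine ⟨i - 1, by omega, ?_, Or.inl ⟨hi, by omega⟩⟩
        have := gadj (i - 1) (by omega)
        rw [Nat.sub_add_cancel hi] at this
        exact this.symm
      · have : i = 0 := by omega
        exact ⟨n - 1, by omega, by rw [this]; exact glast.symm, Or.inr ⟨this, rfl⟩⟩
    have gne : ∀ u v, u < n → v < n → u ≠ v → g u ≠ g v := fun u v hu hv h e =>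
      h (ginj _ _ hu hv e)
    have hab : g a ≠ g b := gne _ _ ha hb (by omega)
    have haj : g a ≠ g j := gne _ _ ha h2 (by omega)
    have hak : g a ≠ g k := gne _ _ ha k2 (by omega)
    have hbj : g b ≠ g j := gne _ _ hb h2 (by omega)
    have hbk : g b ≠ g k := gne _ _ hb k2 (by omega)
    have hjk' : g j ≠ g k := gne _ _ h2 k2 hjk
    have hsub : (↑({g a, g b, g j, g k} : Finset V) : Set V) ⊆ G.neighborSet (g i) := by
      intro v hv
      simp only [Finset.coe_insert, Finset.coe_singleton, Set.mem_insert_iff,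
        Set.mem_singleton_iff] at hv
      rcases hv with rfl | rfl | rfl | rfl
      · exact aadj
      · exact badj
      · exact h3
      · exact k3
    have hc := Set.ncard_le_ncard hsub (Set.toFinite _)
    rw [Set.ncard_coe_finset] at hc
    have h4c : ({g a, g b, g j, g k} : Finset V).card = 4 := by
      rw [Finset.card_insert_of_notMem (by simp [hab, haj, hak]),
        Finset.card_insert_of_notMem (by simp [hbj, hbk]),
        Finset.card_insert_of_notMem (by simp [hjk']), Finset.card_singleton]
    have := hd (g i)
    unfold vdeg at this
    omega
  obtain ⟨x, y, ⟨c1, c2⟩, c3, c4, c5, ⟨c6, c7⟩, c8, c9, c10, c11, c12⟩ :=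
    coords n hn R hs hlt hadj huniq
  obtain ⟨P, hP⟩ : ∃ P : ℕ → Pt, P = fun i => ((x i : ℝ), (y i : ℝ)) := ⟨_, rfl⟩
  have hG : GoodPts n R P := by
    subst hP
    refine ⟨hn, hs, hlt, hadj, huniq, ?_, ?_, ?_, ?_, ?_, ?_, ?_, ?_, ?_, ?_, ?_, ?_⟩ <;>
      try dsimp only
    · exact_mod_cast c1
    · exact_mod_cast c2
    · exact_mod_cast c3
    · exact_mod_cast c4
    · exact_mod_cast c5
    · rw [c6]; push_cast; rfl
    · exact_mod_cast c7
    · intro i h1 h2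
      have := c8 i h1 h2
      constructor
      · have h := this.1
        have h' : ((-(n : ℤ) : ℤ) : ℝ) ≤ (y i : ℝ) := by exact_mod_cast h
        push_cast at h'
        exact h'
      · exact_mod_cast this.2
    · exact_mod_cast c9
    · exact_mod_cast c10
    · exact_mod_cast c11
    · exact_mod_cast c12
  choose idx hidx using gsurj
  have hi1 : ∀ v, idx v < n := fun v => (hidx v).1
  have hi2 : ∀ v, g (idx v) = v := fun v => (hidx v).2
  have hinj : ∀ u v, idx u = idx v → u = v := fun u v h => by rw [← hi2 u, h, hi2]
  have hed : ∀ u v, G.Adj u v → idx u < idx v → GoodPts.Ed n R (idx u) (idx v) := by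
    intro u v h hl
    have h' : G.Adj (g (idx u)) (g (idx v)) := by rw [hi2, hi2]; exact h
    have := hi1 u
    have := hi1 v
    by_cases e1 : idx v = idx u + 1
    · by_cases e2 : 1 ≤ idx u
      · exact Or.inl ⟨e2, e1, hi1 v⟩
      · exact Or.inr (Or.inr (Or.inl ⟨by omega, by omega⟩))
    by_cases e3 : idx u = 0 ∧ idx v = n - 1
    · exact Or.inr (Or.inr (Or.inr (Or.inl e3)))
    have hr : R (idx u) (idx v) := by
      rw [hR]
      exact ⟨hi1 u, hi1 v, h', e1, by omega, e3, by omega⟩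
    by_cases e2 : 1 ≤ idx u
    · exact Or.inr (Or.inl ⟨e2, hl, hr⟩)
    · have e0 : idx u = 0 := by omega
      exact Or.inr (Or.inr (Or.inr (Or.inr ⟨e0, by rw [← e0]; exact hr⟩)))
  have hlg : ∀ u v, G.Adj u v → idx u < idx v ∨ idx v < idx u := by
    intro u v h
    have : idx u ≠ idx v := fun e => h.ne (hinj _ _ e)
    omega
  have hcross : ∀ u v u' v' z, G.Adj u v → G.Adj u' v' → ¬ (u = u' ∧ v = v') →
      ¬ (u = v' ∧ v = u') → z ∈ segment ℝ (P (idx u)) (P (idx v)) →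
      z ∈ segment ℝ (P (idx u')) (P (idx v')) →
      Concl P (idx u) (idx v) (idx u') (idx v') z := by
    intro u v u' v' z h h' n1 n2 s1 s2
    rcases hlg _ _ h with l | l <;> rcases hlg _ _ h' with l' | l'
    · exact hG.cross (hed _ _ h l) (hed _ _ h' l')
        (fun e => n1 ⟨hinj _ _ e.1, hinj _ _ e.2⟩) s1 s2
    · rw [segment_symm] at s2
      exact concl_swapR (hG.cross (hed _ _ h l) (hed _ _ h'.symm l')
        (fun e => n2 ⟨hinj _ _ e.1, hinj _ _ e.2⟩) s1 s2)
    · rw [segment_symm] at s1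
      exact concl_swapL (hG.cross (hed _ _ h.symm l) (hed _ _ h' l')
        (fun e => n2 ⟨hinj _ _ e.2, hinj _ _ e.1⟩) s1 s2)
    · rw [segment_symm] at s1 s2
      exact concl_swapL (concl_swapR (hG.cross (hed _ _ h.symm l) (hed _ _ h'.symm l')
        (fun e => n1 ⟨hinj _ _ e.2, hinj _ _ e.1⟩) s1 s2))
  refine ⟨fun v => P (idx v), ⟨?_, ?_, ?_, ?_⟩, ?_, ?_⟩
  · intro u v h
    exact hinj _ _ (hG.inj (hi1 u) (hi1 v) h)
  · intro u v w h wu wv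
    have wu' : idx w ≠ idx u := fun e => wu (hinj _ _ e)
    have wv' : idx w ≠ idx v := fun e => wv (hinj _ _ e)
    rcases hlg _ _ h with l | l
    · exact hG.off (hed _ _ h l) (hi1 w) wu' wv'
    · rw [segment_symm]
      exact hG.off (hed _ _ h.symm l) (hi1 w) wv' wu'
  · rintro u v w h h' hvw z ⟨s1, s2⟩
    have huw := h'.ne
    rcases hcross u v u w z h h' (fun e => hvw e.2) (fun e => huw e.1) s1 s2 with
      ⟨m, h1, h2, h3⟩ | ⟨⟨h1, _⟩, _⟩
    · rcases h1 with h1 | h1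
      · rw [h1] at h3; exact h3
      · rcases h2 with h2 | h2
        · rw [h2] at h3; exact h3
        · exact absurd (hinj _ _ (h1.symm.trans h2)) hvw
    · exact absurd rfl h1
  · rintro u v u' v' h h' n1 n2 n3 n4 ⟨z, s1, s2⟩
    rcases hcross u v u' v' z h h' (fun e => n1 e.1) (fun e => n2 e.1) s1 s2 with
      ⟨m, h1, h2, h3⟩ | ⟨_, h5⟩
    · exfalso
      rcases h1 with h1 | h1 <;> rcases h2 with h2 | h2
      · exact n1 (hinj _ _ (h1.symm.trans h2))
      · exact n2 (hinj _ _ (h1.symm.trans h2))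
      · exact n3 (hinj _ _ (h1.symm.trans h2))
      · exact n4 (hinj _ _ (h1.symm.trans h2))
    · exact h5
  · rintro q ⟨v, rfl⟩
    exact ⟨x (idx v), y (idx v), by rw [hP]⟩
  · refine ⟨0, -4 * n, ?_⟩
    rintro q ⟨v, rfl⟩
    have key : ∀ i, i < n → 0 ≤ (P i).1 ∧ (P i).1 ≤ 4 * n ∧ -4 * n ≤ (P i).2 ∧
        (P i).2 ≤ 4 * n := by
      intro i hi
      have hn0 : (0 : ℝ) ≤ n := Nat.cast_nonneg n
      by_cases h0 : i = 0
      · subst h0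
        rw [hG.q1, hG.q2]
        refine ⟨?_, ?_, ?_, ?_⟩ <;> linarith
      have hx := hG.xb i (by omega) hi
      have m1 := hG.mono 1 i le_rfl (by omega) hi
      have m2 := hG.mono i (n - 1) (by omega) (by omega) (by omega)
      rw [hG.y1] at m1
      rw [hG.yn] at m2
      exact ⟨hx.1, by linarith [hx.2], m1, m2⟩
    have hn0 : (0 : ℝ) ≤ n := Nat.cast_nonneg n
    obtain ⟨k1, k2, k3, k4⟩ := key (idx v) (hi1 v)
    exact ⟨k1, by linarith, k3, by linarith⟩

/-- There is an absolute constant `c` such that every graph with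
maximum degree 3 on `n` vertices that has a Hamiltonian cycle admits a straight-line RAC
drawing with all vertices on integer grid points inside a square of side `c * n`
(i.e. of `O(n²)` area). -/
theorem stmt13 :
    ∃ c : ℝ, 0 < c ∧
      ∀ (V : Type) [Fintype V] (G : SimpleGraph V),
        (∀ v : V, vdeg G v ≤ 3) →
        (∃ (v : V) (w : G.Walk v v), w.IsHamiltonianCycle) →
        ∃ p : V → Pt, IsRACDrawing G p ∧
          InGridSquare (c * (Fintype.card V : ℝ)) (Set.range p) := by
  refine ⟨8, by norm_num, ?_⟩
  intro V _ G hd ⟨v0, w, hw⟩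
  have hlen : w.length = Fintype.card V := hw.length_eq
  have h3 : 3 ≤ w.length := hw.isCycle.three_le_length
  rw [← hlen]
  refine drawing_of_cycle G hd w.length h3 w.getVert ?_ ?_ ?_ ?_
  · intro i j hi hj e
    exact hw.isCycle.getVert_injOn' (by rw [Set.mem_ofPred_eq]; omega)
      (by rw [Set.mem_ofPred_eq]; omega) e
  · intro v
    obtain ⟨i, hi, hle⟩ := SimpleGraph.Walk.mem_support_iff_exists_getVert.1 (hw.mem_support v)
    rcases Nat.lt_or_ge i w.length with h | h
    · exact ⟨i, h, hi⟩
    · have : i = w.length := by omega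
      refine ⟨0, by omega, ?_⟩
      rw [← hi, this, SimpleGraph.Walk.getVert_length, SimpleGraph.Walk.getVert_zero]
  · intro i hi
    exact w.adj_getVert_succ (by omega)
  · have := w.adj_getVert_succ (i := w.length - 1) (by omega)
    rw [Nat.sub_add_cancel (by omega), SimpleGraph.Walk.getVert_length] at this
    rw [SimpleGraph.Walk.getVert_zero]
    exact this
end
end

section
/- Let G be a 3-edge-colorable graph with maximum degree 3 on n vertices. Then there exists a 3-edge-colorable graph G' with maximum degree 3 and minimum degree at least 2 on at most 3n vertices that contains G as a subgraph (obtained by replacing each degree-1 vertex of G by a 3-cycle). Consequently, if every 3-edge-colorable graph of maximum degree 3 and minimum degree at least 2 admits a straight-line RAC drawing, then so does every 3-edge-colorable graph of maximum degree 3. -/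
open scoped Classical

noncomputable section

lemma colorable_to_fun {V : Type} {G : SimpleGraph V} (h : EdgeColorable G 3) :
    ∃ c : Sym2 V → Fin 3, ∀ u v w, G.Adj u v → G.Adj u w → v ≠ w →
      c s(u, v) ≠ c s(u, w) := by
  obtain ⟨M, hM, -, hU⟩ := h
  have hex : ∀ e : Sym2 V, ∃ i : Fin 3, e ∈ G.edgeSet → e ∈ M i := by
    intro e
    by_cases he : e ∈ G.edgeSet
    · have h2 := he
      rw [← hU] at h2
      obtain ⟨i, hi⟩ := Set.mem_iUnion.1 h2
      exact ⟨i, fun _ => hi⟩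
    · exact ⟨0, fun h => absurd h he⟩
  choose c hc using hex
  refine ⟨c, fun u v w huv huw hvw heq => ?_⟩
  have h1 := hc s(u, v) huv
  have h2 := hc s(u, w) huw
  rw [heq] at h1
  refine (hM _).2 _ h1 _ h2 ?_ u (Sym2.mem_mk_left _ _) (Sym2.mem_mk_left _ _)
  intro h
  exact hvw (Sym2.congr_right.1 h)

lemma colorable_of_fun {V : Type} {G : SimpleGraph V} (c : V → V → Fin 3)
    (hs : ∀ u v, c u v = c v u)
    (hc : ∀ u v w, G.Adj u v → G.Adj u w → v ≠ w → c u v ≠ c u w) :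
    EdgeColorable G 3 := by
  refine ⟨fun i => {e | e ∈ G.edgeSet ∧ Sym2.lift ⟨c, hs⟩ e = i}, ?_, ?_, ?_⟩
  · intro i
    refine ⟨fun e he => he.1, ?_⟩
    rintro e ⟨he, hei⟩ f ⟨hf, hfi⟩ hef v hve hvf
    obtain ⟨a, rfl⟩ := Sym2.mem_iff_exists.1 hve
    obtain ⟨b, rfl⟩ := Sym2.mem_iff_exists.1 hvf
    simp only [Sym2.lift_mk] at hei hfi
    refine hc v a b he hf ?_ (hei.trans hfi.symm)
    rintro rfl
    exact hef rfl
  · intro i j hij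
    rw [Set.disjoint_left]
    rintro e ⟨-, h1⟩ ⟨-, h2⟩
    exact hij (h1.symm.trans h2)
  · ext e
    simp

/-- Three copies of `G`, with a triangle through the copies of each vertex of degree
at most one. -/
def tripled {V : Type} (G : SimpleGraph V) : SimpleGraph (V × Fin 3) where
  Adj a b := (a.2 = b.2 ∧ G.Adj a.1 b.1) ∨ (a.1 = b.1 ∧ a.2 ≠ b.2 ∧ vdeg G a.1 ≤ 1)
  symm := ⟨by
    rintro a b (⟨h1, h2⟩ | ⟨h1, h2, h3⟩)
    · exact Or.inl ⟨h1.symm, h2.symm⟩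
    · exact Or.inr ⟨h1.symm, h2.symm, h1 ▸ h3⟩⟩
  loopless := ⟨by
    rintro a (⟨h1, h2⟩ | ⟨h1, h2, h3⟩)
    · exact G.irrefl h2
    · exact h2 rfl⟩

lemma copy_ncard {V : Type} (G : SimpleGraph V) (u : V) (i : Fin 3) :
    ((fun v => (v, i)) '' G.neighborSet u).ncard = vdeg G u :=
  Set.ncard_image_of_injective _ (fun a b h => (Prod.ext_iff.1 h).1)

lemma tri_ncard {V : Type} (u : V) (i : Fin 3) :
    ((fun j => (u, j)) '' {j : Fin 3 | j ≠ i}).ncard = 2 := by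
  rw [Set.ncard_image_of_injective _ (fun a b h => (Prod.ext_iff.1 h).2)]
  rw [Set.ncard_eq_toFinset_card']
  fin_cases i <;> simp <;> decide

lemma tripled_deg_le {V : Type} [Fintype V] (G : SimpleGraph V)
    (hdeg : ∀ v : V, vdeg G v ≤ 3) (a : V × Fin 3) : vdeg (tripled G) a ≤ 3 := by
  obtain ⟨u, i⟩ := a
  by_cases hu : vdeg G u ≤ 1
  · have hsub : (tripled G).neighborSet (u, i) ⊆
        ((fun v => (v, i)) '' G.neighborSet u) ∪ ((fun j => (u, j)) '' {j : Fin 3 | j ≠ i}) := by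
      rintro ⟨v, j⟩ (⟨h1, h2⟩ | ⟨h1, h2, h3⟩)
      · simp only at h1 h2
        subst h1
        exact Or.inl ⟨v, h2, rfl⟩
      · simp only at h1 h2
        subst h1
        exact Or.inr ⟨j, h2.symm, rfl⟩
    have h1 := Set.ncard_le_ncard hsub (Set.toFinite _)
    have h2 := Set.ncard_union_le ((fun v => (v, i)) '' G.neighborSet u)
      ((fun j => (u, j)) '' {j : Fin 3 | j ≠ i})
    rw [copy_ncard, tri_ncard] at h2
    unfold vdeg at hu h2 ⊢
    omega
  · have hsub : (tripled G).neighborSet (u, i) ⊆ ((fun v => (v, i)) '' G.neighborSet u) := by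
      rintro ⟨v, j⟩ (⟨h1, h2⟩ | ⟨h1, h2, h3⟩)
      · simp only at h1 h2
        subst h1
        exact ⟨v, h2, rfl⟩
      · exact absurd h3 hu
    have h1 := Set.ncard_le_ncard hsub (Set.toFinite _)
    rw [copy_ncard] at h1
    exact h1.trans (hdeg u)

lemma tripled_le_deg {V : Type} [Fintype V] (G : SimpleGraph V)
    (a : V × Fin 3) : 2 ≤ vdeg (tripled G) a := by
  obtain ⟨u, i⟩ := a
  by_cases hu : vdeg G u ≤ 1
  · rw [← tri_ncard u i]
    refine Set.ncard_le_ncard ?_ (Set.toFinite _)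
    rintro _ ⟨j, hj, rfl⟩
    exact Or.inr ⟨rfl, fun h => hj h.symm, hu⟩
  · have h : vdeg G u ≤ vdeg (tripled G) (u, i) := by
      rw [← copy_ncard G u i]
      refine Set.ncard_le_ncard ?_ (Set.toFinite _)
      rintro _ ⟨v, hv, rfl⟩
      exact Or.inl ⟨rfl, hv⟩
    omega

lemma tripled_colorable {V : Type} [Fintype V] (G : SimpleGraph V)
    (h : EdgeColorable G 3) : EdgeColorable (tripled G) 3 := by
  obtain ⟨c, hc⟩ := colorable_to_fun h
  have hd : ∀ u : V, ∃ d : Fin 3, vdeg G u ≤ 1 → ∀ v, G.Adj u v → c s(u, v) = d := by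
    intro u
    by_cases hu : ∃ w, G.Adj u w
    · obtain ⟨w, hw⟩ := hu
      refine ⟨c s(u, w), fun h1 v hv => ?_⟩
      rw [(Set.ncard_le_one (Set.toFinite _)).1 h1 v hv w hw]
    · exact ⟨0, fun _ v hv => absurd ⟨v, hv⟩ hu⟩
  choose d hd using hd
  refine colorable_of_fun
    (fun a b => (if a.1 = b.1 then d a.1 else c s(a.1, b.1)) - (a.2 + b.2)) ?_ ?_
  · rintro ⟨u, i⟩ ⟨v, j⟩
    by_cases huv : u = v
    · subst huv
      simp [add_comm]
    · simp [huv, Ne.symm huv, add_comm, Sym2.eq_swap]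
  · have key : ∀ x i k : Fin 3, i ≠ k → x - (i + i) ≠ x - (i + k) := by decide
    rintro ⟨u, i⟩ ⟨v, j⟩ ⟨w, k⟩ (⟨h1, h2⟩ | ⟨h1, h2, h3⟩) (⟨g1, g2⟩ | ⟨g1, g2, g3⟩) hne <;>
      simp only at h1 h2 g1 g2
    · subst h1 g1
      have hvw : v ≠ w := fun h => hne (by rw [h])
      simp only [h2.ne, g2.ne, if_false]
      intro heq
      exact hc u v w h2 g2 hvw (sub_left_injective heq)
    · subst h1 g1
      simp only [h2.ne, if_false, if_true]
      rw [hd u g3 v h2]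
      exact key _ _ _ g2
    · subst h1 g1
      simp only [g2.ne, if_false, if_true]
      rw [hd u h3 w g2]
      exact (key _ _ _ h2).symm
    · subst h1 g1
      simp only [if_true]
      intro heq
      exact hne (by rw [add_left_cancel (sub_right_injective heq)])

lemma exists_supergraph (V : Type) [Fintype V] (G : SimpleGraph V)
    (hdeg : ∀ v : V, vdeg G v ≤ 3) (hcol : EdgeColorable G 3) :
    ∃ (V' : Type) (inst : Fintype V') (G' : SimpleGraph V') (f : V → V'),
      Function.Injective f ∧
      (∀ u v : V, G.Adj u v → G'.Adj (f u) (f v)) ∧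
      (∀ v' : V', vdeg G' v' ≤ 3) ∧
      (∀ v' : V', 2 ≤ vdeg G' v') ∧
      EdgeColorable G' 3 ∧
      @Fintype.card V' inst ≤ 3 * Fintype.card V := by
  refine ⟨V × Fin 3, inferInstance, tripled G, fun v => (v, 0), ?_, ?_,
    tripled_deg_le G hdeg, tripled_le_deg G, tripled_colorable G hcol, ?_⟩
  · exact fun a b h => (Prod.ext_iff.1 h).1
  · exact fun u v h => Or.inl ⟨rfl, h⟩
  · rw [Fintype.card_prod, Fintype.card_fin, mul_comm]

/-- Let `G` be a 3-edge-colorable graph with maximum degree 3 on `n`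
vertices. Then there is a 3-edge-colorable graph `G'` with maximum degree 3 and minimum
degree at least 2, on at most `3 * n` vertices, containing `G` as a subgraph.
Consequently, if every 3-edge-colorable graph of maximum degree 3 and minimum degree at
least 2 admits a straight-line RAC drawing, then so does every 3-edge-colorable graph of
maximum degree 3. -/
theorem stmt17 (V : Type) [Fintype V] (G : SimpleGraph V)
    (hdeg : ∀ v : V, vdeg G v ≤ 3) (hcol : EdgeColorable G 3) :
    (∃ (V' : Type) (inst : Fintype V') (G' : SimpleGraph V') (f : V → V'),
      Function.Injective f ∧
      (∀ u v : V, G.Adj u v → G'.Adj (f u) (f v)) ∧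
      (∀ v' : V', vdeg G' v' ≤ 3) ∧
      (∀ v' : V', 2 ≤ vdeg G' v') ∧
      EdgeColorable G' 3 ∧
      @Fintype.card V' inst ≤ 3 * Fintype.card V) ∧
    ((∀ (W : Type) [Fintype W], ∀ (H : SimpleGraph W),
        (∀ w : W, vdeg H w ≤ 3) → (∀ w : W, 2 ≤ vdeg H w) → EdgeColorable H 3 →
        ∃ p : W → Pt, IsRACDrawing H p) →
      ∀ (W : Type) [Fintype W], ∀ (H : SimpleGraph W),
        (∀ w : W, vdeg H w ≤ 3) → EdgeColorable H 3 →
        ∃ p : W → Pt, IsRACDrawing H p) := by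
  refine ⟨exists_supergraph V G hdeg hcol, fun hall W _ H hd hc => ?_⟩
  obtain ⟨V', inst, G', f, hf, hadj, h3, h2, hc', -⟩ := exists_supergraph W H hd hc
  obtain ⟨p, hp⟩ := hall V' G' h3 h2 hc'
  refine ⟨p ∘ f, hp.inj.comp hf, ?_, ?_, ?_⟩
  · exact fun u v w h hu hv => hp.vertex_off _ _ _ (hadj _ _ h) (hf.ne hu) (hf.ne hv)
  · exact fun u v w h h' hvw => hp.shared _ _ _ (hadj _ _ h) (hadj _ _ h') (hf.ne hvw)
  · exact fun u v u' v' h h' a b c d => hp.rac _ _ _ _ (hadj _ _ h) (hadj _ _ h')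
      (hf.ne a) (hf.ne b) (hf.ne c) (hf.ne d)
end
end
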